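/- arXiv:math/0611122 — 2 statements merged into one kernel-verified Lean document; each statement's English description precedes it below -/
import Mathlib

section
/- For the invariant algebra of the binary septimic, the numbers δ_n = dim_ℂ(V_n / W_n) of irreducible invariants in low degrees are: δ_4 = 1, δ_8 = 3, δ_12 = 6, δ_14 = 4, δ_16 = 2, δ_18 = 9. -/
open MvPolynomial Finset

/-- The derivation `D1 = t·∂/∂x₁ + 2x₁·∂/∂x₂ + ⋯ + 7x₆·∂/∂x₇` on `ℂ[t, x₁, …, x₇]`,
where the variable of index `0` is `t` and the variable of index `j ≥ 1` is `x_j`. -/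
noncomputable def D1 : Derivation ℂ (MvPolynomial (Fin 8) ℂ) (MvPolynomial (Fin 8) ℂ) :=
  MvPolynomial.mkDerivation ℂ
    ![0, MvPolynomial.X 0, 2 * MvPolynomial.X 1, 3 * MvPolynomial.X 2, 4 * MvPolynomial.X 3,
      5 * MvPolynomial.X 4, 6 * MvPolynomial.X 5, 7 * MvPolynomial.X 6]

/-- The derivation `D2 = 7x₁·∂/∂t + 6x₂·∂/∂x₁ + ⋯ + x₇·∂/∂x₆` on `ℂ[t, x₁, …, x₇]`. -/
noncomputable def D2 : Derivation ℂ (MvPolynomial (Fin 8) ℂ) (MvPolynomial (Fin 8) ℂ) :=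
  MvPolynomial.mkDerivation ℂ
    ![7 * MvPolynomial.X 1, 6 * MvPolynomial.X 2, 5 * MvPolynomial.X 3, 4 * MvPolynomial.X 4,
      3 * MvPolynomial.X 5, 2 * MvPolynomial.X 6, MvPolynomial.X 7, 0]


/-- `V n` is the space of invariants of degree `n` of the binary septimic: homogeneous
polynomials of total degree `n` annihilated by both `D1` and `D2`. -/
noncomputable def V (n : ℕ) : Submodule ℂ (MvPolynomial (Fin 8) ℂ) :=
  MvPolynomial.homogeneousSubmodule (Fin 8) ℂ n ⊓
    LinearMap.ker D1.toLinearMap ⊓ LinearMap.ker D2.toLinearMap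

/-- `W n ⊆ V n` is the `ℂ`-span of the reducible invariants of degree `n`: products
`g·h` of homogeneous invariants `g, h` of positive degrees summing to `n`. -/
noncomputable def W (n : ℕ) : Submodule ℂ (MvPolynomial (Fin 8) ℂ) :=
  Submodule.span ℂ
    {p : MvPolynomial (Fin 8) ℂ | ∃ g h : MvPolynomial (Fin 8) ℂ, ∃ a b : ℕ,
      0 < a ∧ 0 < b ∧ a + b = n ∧ g.IsHomogeneous a ∧ h.IsHomogeneous b ∧
      D1 g = 0 ∧ D2 g = 0 ∧ D1 h = 0 ∧ D2 h = 0 ∧ p = g * h}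

/-- `δ n = dim_ℂ (V n / W n)`, the number of irreducible invariants of degree `n`
(the quotient is formed inside `V n` by pulling `W n` back along the inclusion). -/
noncomputable def delta (n : ℕ) : ℕ :=
  Module.finrank ℂ (↥(V n) ⧸ Submodule.comap (V n).subtype (W n))

/-! ### Counting -/

def cntLoop (c : ℕ → ℕ → ℕ) (n w k : ℕ) : ℕ → ℕ
  | 0 => c n w
  | j + 1 => cntLoop c n w k j + (if (j + 1) ≤ n then c (n - (j + 1)) (w - k * (j + 1)) else 0)

def cnt : ℕ → ℕ → ℕ → ℕ
  | 0, n, w => if w ≤ n then 1 else 0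
  | k + 1, n, w => if (k + 2) * n < w then 0 else cntLoop (cnt k) n w (k + 2) (w / (k + 2))

lemma cntLoop_eq (c : ℕ → ℕ → ℕ) (n w k m : ℕ) :
    cntLoop c n w k m =
      ∑ j ∈ Finset.range (m + 1), if j ≤ n then c (n - j) (w - k * j) else 0 := by
  induction m with
  | zero => simp [cntLoop]
  | succ m ih => rw [Finset.sum_range_succ, ← ih, cntLoop]

/-- functions with prescribed sum and weighted sum -/
def PS : (k : ℕ) → ℕ → ℕ → Finset (Fin (k + 2) → ℕ)
  | 0, n, w => if w ≤ n then {![n - w, w]} else ∅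
  | k + 1, n, w => (Finset.range (w / (k + 2) + 1)).biUnion fun j =>
      if j ≤ n then (PS k (n - j) (w - (k + 2) * j)).image
        (fun g => (Fin.snoc g j : Fin (k + 2 + 1) → ℕ)) else ∅

lemma mem_PS (k n w : ℕ) (f : Fin (k + 2) → ℕ) :
    f ∈ PS k n w ↔ ∑ i, f i = n ∧ ∑ i : Fin _, (i : ℕ) * f i = w := by
  induction k generalizing n w with
  | zero =>
    rw [show ∑ i, f i = f 0 + f 1 from Fin.sum_univ_two f,
      show ∑ i : Fin (0 + 2), (i : ℕ) * f i = ((0 : Fin 2) : ℕ) * f 0 + ((1 : Fin 2) : ℕ) * f 1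
        from Fin.sum_univ_two _]
    simp only [PS]
    split_ifs with h
    · rw [Finset.mem_singleton]
      constructor
      · rintro rfl
        simp; omega
      · rintro ⟨h1, h2⟩
        simp at h2
        ext i
        fin_cases i
        · simp; omega
        · simp; omega
    · simp; omega
  | succ k ih =>
    simp only [PS, Finset.mem_biUnion, Finset.mem_range]
    rw [Fin.sum_univ_castSucc f, Fin.sum_univ_castSucc fun i : Fin (k + 2 + 1) => (i : ℕ) * f i]
    simp only [Fin.val_castSucc, Fin.val_last]
    constructor
    · rintro ⟨j, hj, hf⟩
      split_ifs at hf with hjn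
      · rw [Finset.mem_image] at hf
        obtain ⟨g, hg, rfl⟩ := hf
        rw [ih] at hg
        simp only [Fin.snoc_castSucc, Fin.snoc_last]
        have : (k + 2) * j ≤ w := by
          have := Nat.div_mul_le_self w (k + 2)
          have : j * (k + 2) ≤ w / (k + 2) * (k + 2) := Nat.mul_le_mul_right _ (by omega)
          linarith [mul_comm j (k + 2)]
        have e : (k + 2 : ℕ) = k + 1 + 1 := rfl
        rw [hg.1, hg.2]
        exact ⟨by omega, by rw [← e]; omega⟩
      · simp at hf
    · rintro ⟨h1, h2⟩
      refine ⟨f (Fin.last _), ?_, ?_⟩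
      · rw [Nat.lt_succ_iff, Nat.le_div_iff_mul_le (by omega)]
        rw [mul_comm]; omega
      · rw [if_pos (by omega), Finset.mem_image]
        refine ⟨fun i => f i.castSucc, ?_, ?_⟩
        · rw [ih]
          constructor <;> omega
        · exact Fin.snoc_init_self f

lemma card_PS (k n w : ℕ) : (PS k n w).card = cnt k n w := by
  induction k generalizing n w with
  | zero =>
    simp only [PS, cnt]; split_ifs <;> simp
  | succ k ih =>
    rw [cnt]
    split_ifs with h
    · rw [Finset.card_eq_zero, Finset.eq_empty_iff_forall_notMem]
      intro f hf
      rw [mem_PS] at hf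
      have : ∑ i : Fin _, (i : ℕ) * f i ≤ ∑ i, (k + 2) * f i :=
        Finset.sum_le_sum fun i _ => Nat.mul_le_mul_right _ (by omega)
      rw [← Finset.mul_sum, hf.1, hf.2] at this
      omega
    · rw [cntLoop_eq, PS, Finset.card_biUnion]
      · refine Finset.sum_congr rfl fun j _ => ?_
        split_ifs
        · rw [Finset.card_image_of_injective, ih]
          intro a b hab
          exact (Fin.snoc_inj.1 hab).1
        · simp
      · intro x _ y _ hxy
        rw [Function.onFun, Finset.disjoint_left]
        intro f hx hy
        split_ifs at hx hy
        · rw [Finset.mem_image] at hx hy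
          obtain ⟨g, _, rfl⟩ := hx
          obtain ⟨g', _, h'⟩ := hy
          exact hxy (Fin.snoc_inj.1 h').2.symm
        all_goals simp at hx hy

lemma cnt_vals : (cnt 6 2 7 = 4 ∧ cnt 6 2 6 = 4) ∧ (cnt 6 4 14 = 24 ∧ cnt 6 4 13 = 23) ∧
    (cnt 6 6 21 = 94 ∧ cnt 6 6 20 = 94) ∧ (cnt 6 8 28 = 289 ∧ cnt 6 8 27 = 285) ∧
    (cnt 6 10 35 = 734 ∧ cnt 6 10 34 = 734) ∧ (cnt 6 12 42 = 1656 ∧ cnt 6 12 41 = 1646) ∧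
    (cnt 6 14 49 = 3370 ∧ cnt 6 14 48 = 3366) ∧ (cnt 6 16 56 = 6375 ∧ cnt 6 16 55 = 6357) ∧
    (cnt 6 18 63 = 11322 ∧ cnt 6 18 62 = 11309) := by
  decide +kernel
set_option linter.unusedSimpArgs false
set_option linter.unreachableTactic false
set_option linter.unusedTactic false
/-! ### The `sl₂` action -/

noncomputable def diagD (c : Fin 8 → ℂ) :
    Derivation ℂ (MvPolynomial (Fin 8) ℂ) (MvPolynomial (Fin 8) ℂ) :=
  MvPolynomial.mkDerivation ℂ fun i => c i • MvPolynomial.X i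

lemma coeff_diagD (c : Fin 8 → ℂ) (p : MvPolynomial (Fin 8) ℂ) (s : Fin 8 →₀ ℕ) :
    coeff s (diagD c p) = (∑ i, c i * (s i : ℂ)) * coeff s p := by
  classical
  induction p using MvPolynomial.induction_on' with
  | add p q hp hq => rw [map_add, coeff_add, coeff_add, hp, hq, mul_add]
  | monomial u a =>
    rw [diagD, mkDerivation_monomial]
    have : (u.sum fun i k => monomial (u - Finsupp.single i 1) (k : ℂ) •
        (c i • (X i : MvPolynomial (Fin 8) ℂ))) = monomial u (∑ i, c i * (u i : ℂ)) := by
      rw [Finsupp.sum, map_sum]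
      rw [← Finset.sum_subset (Finset.subset_univ u.support)]
      · refine Finset.sum_congr rfl fun i hi => ?_
        have h1 : Finsupp.single i 1 ≤ u := by
          rw [Finsupp.single_le_iff]
          have := Finsupp.mem_support_iff.1 hi
          omega
        rw [smul_eq_mul, X, smul_monomial, monomial_mul, tsub_add_cancel_of_le h1]
        simp [mul_comm]
      · intro i _ hi
        rw [Finsupp.notMem_support_iff.1 hi]; simp
    rw [this, smul_monomial, coeff_monomial, coeff_monomial]
    split_ifs with h
    · subst h; simp [mul_comm]
    · simp

noncomputable def Ed := diagD fun _ => 1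
noncomputable def Td := diagD fun i => ((i : ℕ) : ℂ)

lemma der_ofNat (D : Derivation ℂ (MvPolynomial (Fin 8) ℂ) (MvPolynomial (Fin 8) ℂ)) (n : ℕ)
    [n.AtLeastTwo] : D ofNat(n) = 0 := D.map_natCast n

lemma C_num (n : ℕ) [n.AtLeastTwo] :
    (C (ofNat(n) : ℂ) : MvPolynomial (Fin 8) ℂ) = ofNat(n) := map_ofNat C n

lemma comm12 (p : MvPolynomial (Fin 8) ℂ) :
    D1 (D2 p) = D2 (D1 p) + (7 : ℂ) • Ed p - (2 : ℂ) • Td p := by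
  have h : ⁅D1, D2⁆ = (7 : ℂ) • Ed - (2 : ℂ) • Td := by
    apply derivation_ext
    intro i
    rw [Derivation.commutator_apply]
    fin_cases i <;>
    simp [D1, D2, Ed, Td, diagD, mkDerivation_X, MvPolynomial.smul_eq_C_mul, der_ofNat, C_num] <;>
    ring
  have := congrArg (fun D => D p) h
  simp only [Derivation.commutator_apply, Derivation.sub_apply, Derivation.smul_apply] at this
  rw [add_sub_assoc, ← this]; ring

lemma commE1 (p : MvPolynomial (Fin 8) ℂ) : Ed (D1 p) = D1 (Ed p) := by
  have h : ⁅Ed, D1⁆ = 0 := by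
    apply derivation_ext
    intro i
    rw [Derivation.commutator_apply]
    fin_cases i <;>
    simp [D1, D2, Ed, Td, diagD, mkDerivation_X, MvPolynomial.smul_eq_C_mul, der_ofNat, C_num]
  have := congrArg (fun D => D p) h
  simp only [Derivation.commutator_apply, Derivation.zero_apply] at this
  exact sub_eq_zero.1 this

lemma commE2 (p : MvPolynomial (Fin 8) ℂ) : Ed (D2 p) = D2 (Ed p) := by
  have h : ⁅Ed, D2⁆ = 0 := by
    apply derivation_ext
    intro i
    rw [Derivation.commutator_apply]
    fin_cases i <;>
    simp [D1, D2, Ed, Td, diagD, mkDerivation_X, MvPolynomial.smul_eq_C_mul, der_ofNat, C_num]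
  have := congrArg (fun D => D p) h
  simp only [Derivation.commutator_apply, Derivation.zero_apply] at this
  exact sub_eq_zero.1 this

lemma commT1 (p : MvPolynomial (Fin 8) ℂ) : Td (D1 p) = D1 (Td p) - D1 p := by
  have h : ⁅Td, D1⁆ = -D1 := by
    apply derivation_ext
    intro i
    rw [Derivation.commutator_apply]
    fin_cases i <;>
    simp [D1, D2, Ed, Td, diagD, mkDerivation_X, MvPolynomial.smul_eq_C_mul, der_ofNat, C_num] <;> ring
  have := congrArg (fun D => D p) h
  simp only [Derivation.commutator_apply, Derivation.neg_apply] at this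
  linear_combination this

lemma commT2 (p : MvPolynomial (Fin 8) ℂ) : Td (D2 p) = D2 (Td p) + D2 p := by
  have h : ⁅Td, D2⁆ = D2 := by
    apply derivation_ext
    intro i
    rw [Derivation.commutator_apply]
    fin_cases i <;>
    simp [D1, D2, Ed, Td, diagD, mkDerivation_X, MvPolynomial.smul_eq_C_mul, der_ofNat, C_num] <;> ring
  have := congrArg (fun D => D p) h
  simp only [Derivation.commutator_apply] at this
  linear_combination this
lemma dsmul (D : Derivation ℂ (MvPolynomial (Fin 8) ℂ) (MvPolynomial (Fin 8) ℂ)) (c : ℂ)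
    (p : MvPolynomial (Fin 8) ℂ) : D (c • p) = c • D p := D.map_smul c p

/-- weight spaces -/
noncomputable def M (n : ℕ) (w : ℂ) : Submodule ℂ (MvPolynomial (Fin 8) ℂ) where
  carrier := {p | Ed p = (n : ℂ) • p ∧ Td p = w • p}
  add_mem' := by
    rintro a b ⟨h1, h2⟩ ⟨h3, h4⟩
    exact ⟨by rw [map_add, h1, h3, smul_add], by rw [map_add, h2, h4, smul_add]⟩
  zero_mem' := by simp
  smul_mem' := by
    rintro c a ⟨h1, h2⟩
    exact ⟨by rw [dsmul, h1, smul_comm], by rw [dsmul, h2, smul_comm]⟩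

lemma mem_M {n : ℕ} {w : ℂ} {p : MvPolynomial (Fin 8) ℂ} :
    p ∈ M n w ↔ Ed p = (n : ℂ) • p ∧ Td p = w • p := Iff.rfl

lemma diagD_eig (c : Fin 8 → ℂ) (p : MvPolynomial (Fin 8) ℂ) (w : ℂ) :
    diagD c p = w • p ↔ ∀ s ∈ p.support, ∑ i, c i * (s i : ℂ) = w := by
  constructor
  · intro h s hs
    have := congrArg (coeff s) h
    rw [coeff_diagD, coeff_smul, smul_eq_mul] at this
    exact mul_right_cancel₀ (mem_support_iff.1 hs) this
  · intro h
    ext s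
    rw [coeff_diagD, coeff_smul, smul_eq_mul]
    by_cases hs : s ∈ p.support
    · rw [h s hs]
    · rw [notMem_support_iff.1 hs]; simp

lemma Ed_eig (p : MvPolynomial (Fin 8) ℂ) (n : ℕ) :
    Ed p = (n : ℂ) • p ↔ ∀ s ∈ p.support, ∑ i, s i = n := by
  rw [Ed, diagD_eig]
  refine forall₂_congr fun s _ => ?_
  simp only [one_mul]
  exact_mod_cast Iff.rfl

lemma Td_eig (p : MvPolynomial (Fin 8) ℂ) (w : ℂ) :
    Td p = w • p ↔ ∀ s ∈ p.support, ((∑ i : Fin 8, (i : ℕ) * s i : ℕ) : ℂ) = w := by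
  rw [Td, diagD_eig]
  refine forall₂_congr fun s _ => ?_
  push_cast
  exact Iff.rfl

lemma hom_iff (p : MvPolynomial (Fin 8) ℂ) (n : ℕ) :
    p.IsHomogeneous n ↔ Ed p = (n : ℂ) • p := by
  rw [Ed_eig]
  have key : ∀ s : Fin 8 →₀ ℕ, Finsupp.weight 1 s = ∑ i, s i := by
    intro s
    rw [Finsupp.weight_apply, Finsupp.sum_fintype _ _ (by simp)]
    simp
  constructor
  · intro h s hs
    rw [← key]
    exact h (mem_support_iff.1 hs)
  · intro h s hs
    rw [key]
    exact h s (mem_support_iff.2 hs)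

lemma M_eq_zero {n : ℕ} {w : ℂ} (hw : ∀ m : ℕ, m ≤ 7 * n → (m : ℂ) ≠ w)
    {p : MvPolynomial (Fin 8) ℂ} (hp : p ∈ M n w) : p = 0 := by
  rw [mem_M, Ed_eig, Td_eig] at hp
  rw [← support_eq_empty, Finset.eq_empty_iff_forall_notMem]
  intro s hs
  refine hw _ ?_ (hp.2 s hs)
  rw [← hp.1 s hs, Finset.mul_sum]
  exact Finset.sum_le_sum fun i _ => Nat.mul_le_mul_right _ (by omega)

lemma D1_M {n : ℕ} {w : ℂ} {p : MvPolynomial (Fin 8) ℂ} (hp : p ∈ M n w) :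
    D1 p ∈ M n (w - 1) := by
  rw [mem_M] at hp ⊢
  rw [commE1, commT1, hp.1, hp.2, dsmul, dsmul, sub_smul, one_smul]
  exact ⟨rfl, rfl⟩

lemma D2_M {n : ℕ} {w : ℂ} {p : MvPolynomial (Fin 8) ℂ} (hp : p ∈ M n w) :
    D2 p ∈ M n (w + 1) := by
  rw [mem_M] at hp ⊢
  rw [commE2, commT2, hp.1, hp.2, dsmul, dsmul, add_smul, one_smul]
  exact ⟨rfl, rfl⟩

lemma comm_M {n : ℕ} {w : ℂ} {p : MvPolynomial (Fin 8) ℂ} (hp : p ∈ M n w) :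
    D1 (D2 p) = D2 (D1 p) + (7 * n - 2 * w : ℂ) • p := by
  rw [comm12, hp.1, hp.2]; module

lemma killA {n : ℕ} {w : ℂ} (hw : 2 * w = 7 * n) {p : MvPolynomial (Fin 8) ℂ}
    (hp : p ∈ M n w) (h1 : D1 p = 0) : D2 p = 0 := by
  have hM : ∀ k : ℕ, (D2^[k]) p ∈ M n (w + k) := by
    intro k
    induction k with
    | zero => simpa using hp
    | succ k ih =>
      rw [Function.iterate_succ_apply']
      have := D2_M ih
      rwa [add_assoc, ← Nat.cast_succ] at this
  have hc : ∀ k : ℕ, D1 ((D2^[k + 1]) p) = (-(k * (k + 1)) : ℂ) • (D2^[k]) p := by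
    intro k
    induction k with
    | zero =>
      have := comm_M hp
      rw [h1, hw] at this
      simpa using this
    | succ k ih =>
      rw [Function.iterate_succ_apply', comm_M (hM (k + 1)), ih, dsmul,
        ← Function.iterate_succ_apply' (f := D2), ← add_smul]
      congr 1
      push_cast
      linear_combination -hw
  have hz : (D2^[4 * n + 1]) p = 0 := by
    refine M_eq_zero ?_ (hM _)
    intro m hm h
    have : ((2 * m : ℕ) : ℂ) = ((7 * n + 2 * (4 * n + 1) : ℕ) : ℂ) := by
      push_cast at h ⊢
      linear_combination 2 * h + hw
    have := Nat.cast_injective this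
    omega
  have hd : ∀ k : ℕ, (D2^[k + 1]) p = 0 → D2 p = 0 := by
    intro k
    induction k with
    | zero => exact id
    | succ k ih =>
      intro h
      apply ih
      have := hc (k + 1)
      rw [h, map_zero] at this
      refine (smul_eq_zero.1 this.symm).resolve_left ?_
      change _ ≠ _
      rw [neg_ne_zero]
      exact_mod_cast (by positivity : (k + 1) * (k + 1 + 1) ≠ 0)
  exact hd _ hz

lemma killB {n : ℕ} {w : ℂ} (hw : 7 * n - 2 * w = 2) {p : MvPolynomial (Fin 8) ℂ}
    (hp : p ∈ M n w) (h1 : D1 (D2 p) = 0) : p = 0 := by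
  have hM : ∀ k : ℕ, (D1^[k]) p ∈ M n (w - k) := by
    intro k
    induction k with
    | zero => simpa using hp
    | succ k ih =>
      rw [Function.iterate_succ_apply']
      have := D1_M ih
      rwa [sub_sub, ← Nat.cast_succ] at this
  have hc : ∀ k : ℕ, D2 ((D1^[k + 1]) p) = (-((k + 1) * (k + 2)) : ℂ) • (D1^[k]) p := by
    intro k
    induction k with
    | zero =>
      have := comm_M hp
      rw [h1, hw] at this
      simp only [zero_add, Function.iterate_one, Function.iterate_zero, id]
      rw [eq_comm, add_eq_zero_iff_eq_neg] at this
      rw [this]; push_cast; module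
    | succ k ih =>
      have := comm_M (hM (k + 1))
      rw [ih, dsmul, ← Function.iterate_succ_apply' (f := D1)] at this
      rw [Function.iterate_succ_apply', ← sub_eq_iff_eq_add.2 this, ← sub_smul]
      congr 1
      push_cast
      linear_combination -hw
  have hz : (D1^[4 * n]) p = 0 := by
    refine M_eq_zero ?_ (hM _)
    intro m hm h
    have : ((2 * m + 8 * n + 2 : ℕ) : ℂ) = ((7 * n : ℕ) : ℂ) := by
      push_cast at h ⊢
      linear_combination 2 * h - hw
    have := Nat.cast_injective this
    omega
  have hd : ∀ k : ℕ, (D1^[k]) p = 0 → p = 0 := by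
    intro k
    induction k with
    | zero => exact id
    | succ k ih =>
      intro h
      apply ih
      have := hc k
      rw [h, map_zero] at this
      refine (smul_eq_zero.1 this.symm).resolve_left ?_
      change _ ≠ _
      rw [neg_ne_zero]
      exact_mod_cast (by positivity : (k + 1) * (k + 2) ≠ 0)
  exact hd _ hz

lemma mem_V {n : ℕ} {p : MvPolynomial (Fin 8) ℂ} :
    p ∈ V n ↔ p.IsHomogeneous n ∧ D1 p = 0 ∧ D2 p = 0 := by
  simp [V, and_assoc, mem_homogeneousSubmodule]

lemma mem_V_iff {n : ℕ} {w : ℂ} (hw : 2 * w = 7 * n) {p : MvPolynomial (Fin 8) ℂ} :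
    p ∈ V n ↔ p ∈ M n w ∧ D1 p = 0 := by
  rw [mem_V, hom_iff]
  constructor
  · rintro ⟨h, h1, h2⟩
    refine ⟨⟨h, ?_⟩, h1⟩
    have := comm12 p
    rw [h1, h2, h, map_zero, map_zero] at this
    have h3 : (2 : ℂ) • Td p = (2 : ℂ) • (w • p) := by
      rw [smul_smul, hw]
      rw [zero_add, eq_comm, sub_eq_zero, smul_smul] at this
      exact this.symm
    exact smul_right_injective _ (two_ne_zero) h3
  · rintro ⟨h, h1⟩
    exact ⟨h.1, h1, killA hw h h1⟩

lemma V_odd {n : ℕ} (hn : n % 2 = 1) {p : MvPolynomial (Fin 8) ℂ} (hp : p ∈ V n) : p = 0 := by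
  rw [mem_V_iff (w := 7 * n / 2) (by ring)] at hp
  refine M_eq_zero ?_ hp.1
  intro m _ h
  have : ((2 * m : ℕ) : ℂ) = ((7 * n : ℕ) : ℂ) := by
    push_cast
    rw [h]; ring
  have := Nat.cast_injective this
  omega

lemma M_eq_restrict (n w : ℕ) :
    M n w = restrictSupport ℂ {s : Fin 8 →₀ ℕ | ∑ i, s i = n ∧ ∑ i : Fin 8, (i : ℕ) * s i = w} := by
  ext p
  rw [mem_M, Ed_eig, Td_eig, mem_restrictSupport_iff]
  simp only [Nat.cast_inj]
  rw [← forall₂_and]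
  rfl

noncomputable def idxEquiv (n w : ℕ) :
    {s : Fin 8 →₀ ℕ | ∑ i, s i = n ∧ ∑ i : Fin 8, (i : ℕ) * s i = w} ≃ PS 6 n w :=
  Equiv.subtypeEquiv Finsupp.equivFunOnFinite (fun s => by
    rw [mem_PS]; rfl)

noncomputable def MBasis (n w : ℕ) : Module.Basis (PS 6 n w) ℂ (M n w) :=
  ((basisRestrictSupport ℂ _).map (LinearEquiv.ofEq _ _ (M_eq_restrict n w).symm)).reindex
    (idxEquiv n w)

instance (n w : ℕ) : FiniteDimensional ℂ (M n w) := Module.Basis.finiteDimensional_of_finite (MBasis n w)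

lemma finrank_M (n w : ℕ) : Module.finrank ℂ (M n w) = cnt 6 n w := by
  rw [Module.finrank_eq_card_basis (MBasis n w), Fintype.card_coe, card_PS]

lemma finrank_V (n w : ℕ) (hw : 2 * (w + 1) = 7 * n) :
    FiniteDimensional ℂ (V n) ∧ Module.finrank ℂ (V n) + cnt 6 n w = cnt 6 n (w + 1) := by
  have hwc : 2 * ((w + 1 : ℕ) : ℂ) = 7 * n := by exact_mod_cast hw
  have hle : V n ≤ M n ((w + 1 : ℕ) : ℂ) := fun p hp => ((mem_V_iff hwc).1 hp).1
  have e1 : ∀ p ∈ M n ((w + 1 : ℕ) : ℂ), D1.toLinearMap p ∈ M n (w : ℂ) := by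
    intro p hp
    have := D1_M hp
    rwa [show ((w + 1 : ℕ) : ℂ) - 1 = w by push_cast; ring] at this
  have e2 : ∀ p ∈ M n (w : ℂ), D2.toLinearMap p ∈ M n ((w + 1 : ℕ) : ℂ) := by
    intro p hp
    have := D2_M hp
    rwa [← Nat.cast_succ] at this
  let φ := D1.toLinearMap.restrict e1
  let ψ := D2.toLinearMap.restrict e2
  have hinj : Function.Injective (φ ∘ₗ ψ) := by
    rw [← LinearMap.ker_eq_bot, LinearMap.ker_eq_bot']
    intro m hm
    apply Subtype.ext
    refine killB (n := n) (w := w) ?_ m.2 (congrArg Subtype.val hm)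
    push_cast at hwc
    linear_combination -hwc
  have hsurj : Function.Surjective φ := by
    have := LinearMap.injective_iff_surjective.1 hinj
    rw [LinearMap.coe_comp] at this
    exact this.of_comp
  have hker : (LinearMap.ker φ).map (M n ((w + 1 : ℕ) : ℂ)).subtype = V n := by
    ext p
    rw [mem_V_iff hwc]
    constructor
    · rintro ⟨q, hq, rfl⟩
      exact ⟨q.2, congrArg Subtype.val hq⟩
    · rintro ⟨h, h1⟩
      exact ⟨⟨p, h⟩, Subtype.ext h1, rfl⟩
  have := LinearMap.finrank_range_add_finrank_ker φ
  rw [LinearMap.range_eq_top.2 hsurj, finrank_top, finrank_M, finrank_M] at this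
  have hf : Module.finrank ℂ (V n) = Module.finrank ℂ (LinearMap.ker φ) := by
    rw [← hker]
    exact Submodule.finrank_map_subtype_eq _ _
  refine ⟨Submodule.finiteDimensional_of_le hle, ?_⟩
  rw [hf]; omega
/-! ### Explicit invariants -/

noncomputable def qv0 : MvPolynomial (Fin 8) ℂ := 2 * X 0 * X 6 - 12 * X 1 * X 5 + 30 * X 2 * X 4 - 20 * X 3 * X 3
noncomputable def qv1 : MvPolynomial (Fin 8) ℂ := X 0 * X 7 - 5 * X 1 * X 6 + 9 * X 2 * X 5 - 5 * X 3 * X 4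
noncomputable def qv2 : MvPolynomial (Fin 8) ℂ := 2 * X 1 * X 7 - 12 * X 2 * X 6 + 30 * X 3 * X 5 - 20 * X 4 * X 4
noncomputable def sv0 : MvPolynomial (Fin 8) ℂ := 20 * X 0 * X 4 - 80 * X 1 * X 3 + 60 * X 2 * X 2
noncomputable def sv1 : MvPolynomial (Fin 8) ℂ := 10 * X 0 * X 5 - 30 * X 1 * X 4 + 20 * X 2 * X 3
noncomputable def sv2 : MvPolynomial (Fin 8) ℂ := 4 * X 0 * X 6 - 4 * X 1 * X 5 - 20 * X 2 * X 4 + 20 * X 3 * X 3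
noncomputable def sv3 : MvPolynomial (Fin 8) ℂ := X 0 * X 7 + 5 * X 1 * X 6 - 21 * X 2 * X 5 + 15 * X 3 * X 4
noncomputable def sv4 : MvPolynomial (Fin 8) ℂ := 4 * X 1 * X 7 - 4 * X 2 * X 6 - 20 * X 3 * X 5 + 20 * X 4 * X 4
noncomputable def sv5 : MvPolynomial (Fin 8) ℂ := 10 * X 2 * X 7 - 30 * X 3 * X 6 + 20 * X 4 * X 5
noncomputable def sv6 : MvPolynomial (Fin 8) ℂ := 20 * X 3 * X 7 - 80 * X 4 * X 6 + 60 * X 5 * X 5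
noncomputable def iv0 : MvPolynomial (Fin 8) ℂ := 6 * sv0 * sv4 - 24 * sv1 * sv3 + 18 * sv2 * sv2
noncomputable def iv1 : MvPolynomial (Fin 8) ℂ := 3 * sv0 * sv5 - 9 * sv1 * sv4 + 6 * sv2 * sv3
noncomputable def iv2 : MvPolynomial (Fin 8) ℂ := sv0 * sv6 - 9 * sv2 * sv4 + 8 * sv3 * sv3
noncomputable def iv3 : MvPolynomial (Fin 8) ℂ := 3 * sv1 * sv6 - 9 * sv2 * sv5 + 6 * sv3 * sv4
noncomputable def iv4 : MvPolynomial (Fin 8) ℂ := 6 * sv2 * sv6 - 24 * sv3 * sv5 + 18 * sv4 * sv4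
noncomputable def rv0 : MvPolynomial (Fin 8) ℂ := qv0 * sv2 - 2 * qv1 * sv1 + qv2 * sv0
noncomputable def rv1 : MvPolynomial (Fin 8) ℂ := qv0 * sv3 - 2 * qv1 * sv2 + qv2 * sv1
noncomputable def rv2 : MvPolynomial (Fin 8) ℂ := qv0 * sv4 - 2 * qv1 * sv3 + qv2 * sv2
noncomputable def rv3 : MvPolynomial (Fin 8) ℂ := qv0 * sv5 - 2 * qv1 * sv4 + qv2 * sv3
noncomputable def rv4 : MvPolynomial (Fin 8) ℂ := qv0 * sv6 - 2 * qv1 * sv5 + qv2 * sv4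
noncomputable def vv0 : MvPolynomial (Fin 8) ℂ := qv0 * rv2 - 2 * qv1 * rv1 + qv2 * rv0
noncomputable def vv1 : MvPolynomial (Fin 8) ℂ := qv0 * rv3 - 2 * qv1 * rv2 + qv2 * rv1
noncomputable def vv2 : MvPolynomial (Fin 8) ℂ := qv0 * rv4 - 2 * qv1 * rv3 + qv2 * rv2
noncomputable def invF : MvPolynomial (Fin 8) ℂ := qv0 * qv2 - qv1 * qv1
noncomputable def invA : MvPolynomial (Fin 8) ℂ := qv0 * vv2 - 2 * qv1 * vv1 + qv2 * vv0
noncomputable def invB : MvPolynomial (Fin 8) ℂ := rv0 * rv4 - 4 * rv1 * rv3 + 3 * rv2 * rv2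
noncomputable def invC : MvPolynomial (Fin 8) ℂ := iv0 * rv4 - 4 * iv1 * rv3 + 6 * iv2 * rv2 - 4 * iv3 * rv1 + iv4 * rv0

lemma D1_x : D1 (X 0) = 0 ∧ D1 (X 1) = X 0 ∧ D1 (X 2) = 2 * X 1 ∧ D1 (X 3) = 3 * X 2 ∧ D1 (X 4) = 4 * X 3 ∧ D1 (X 5) = 5 * X 4 ∧ D1 (X 6) = 6 * X 5 ∧ D1 (X 7) = 7 * X 6 := by
  refine ⟨?_, ?_, ?_, ?_, ?_, ?_, ?_, ?_⟩ <;> simp [D1, D2, Ed, diagD, mkDerivation_X]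

lemma D2_x : D2 (X 0) = 7 * X 1 ∧ D2 (X 1) = 6 * X 2 ∧ D2 (X 2) = 5 * X 3 ∧ D2 (X 3) = 4 * X 4 ∧ D2 (X 4) = 3 * X 5 ∧ D2 (X 5) = 2 * X 6 ∧ D2 (X 6) = X 7 ∧ D2 (X 7) = 0 := by
  refine ⟨?_, ?_, ?_, ?_, ?_, ?_, ?_, ?_⟩ <;> simp [D1, D2, Ed, diagD, mkDerivation_X]

lemma Ed_x : Ed (X 0) = X 0 ∧ Ed (X 1) = X 1 ∧ Ed (X 2) = X 2 ∧ Ed (X 3) = X 3 ∧ Ed (X 4) = X 4 ∧ Ed (X 5) = X 5 ∧ Ed (X 6) = X 6 ∧ Ed (X 7) = X 7 := by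
  refine ⟨?_, ?_, ?_, ?_, ?_, ?_, ?_, ?_⟩ <;> simp [D1, D2, Ed, diagD, mkDerivation_X]

lemma D1_q : D1 qv0 = 0 ∧
    D1 qv1 = 1 * qv0 ∧
    D1 qv2 = 2 * qv1 := by
  obtain ⟨hx0, hx1, hx2, hx3, hx4, hx5, hx6, hx7⟩ := D1_x
  refine ⟨?_, ?_, ?_⟩ <;>
  simp only [qv0, qv1, qv2, map_add, map_sub, Derivation.leibniz, smul_eq_mul, der_ofNat, mul_zero, zero_mul, hx0, hx1, hx2, hx3, hx4, hx5, hx6, hx7] <;> ring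

lemma D2_q : D2 qv0 = 2 * qv1 ∧
    D2 qv1 = 1 * qv2 ∧
    D2 qv2 = 0 := by
  obtain ⟨hx0, hx1, hx2, hx3, hx4, hx5, hx6, hx7⟩ := D2_x
  refine ⟨?_, ?_, ?_⟩ <;>
  simp only [qv0, qv1, qv2, map_add, map_sub, Derivation.leibniz, smul_eq_mul, der_ofNat, mul_zero, zero_mul, hx0, hx1, hx2, hx3, hx4, hx5, hx6, hx7] <;> ring

lemma Ed_q : Ed qv0 = 2 * qv0 ∧
    Ed qv1 = 2 * qv1 ∧
    Ed qv2 = 2 * qv2 := by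
  obtain ⟨hx0, hx1, hx2, hx3, hx4, hx5, hx6, hx7⟩ := Ed_x
  refine ⟨?_, ?_, ?_⟩ <;>
  simp only [qv0, qv1, qv2, map_add, map_sub, Derivation.leibniz, smul_eq_mul, der_ofNat, mul_zero, zero_mul, hx0, hx1, hx2, hx3, hx4, hx5, hx6, hx7] <;> ring

lemma D1_s : D1 sv0 = 0 ∧
    D1 sv1 = 1 * sv0 ∧
    D1 sv2 = 2 * sv1 ∧
    D1 sv3 = 3 * sv2 ∧
    D1 sv4 = 4 * sv3 ∧
    D1 sv5 = 5 * sv4 ∧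
    D1 sv6 = 6 * sv5 := by
  obtain ⟨hx0, hx1, hx2, hx3, hx4, hx5, hx6, hx7⟩ := D1_x
  refine ⟨?_, ?_, ?_, ?_, ?_, ?_, ?_⟩ <;>
  simp only [sv0, sv1, sv2, sv3, sv4, sv5, sv6, map_add, map_sub, Derivation.leibniz, smul_eq_mul, der_ofNat, mul_zero, zero_mul, hx0, hx1, hx2, hx3, hx4, hx5, hx6, hx7] <;> ring

lemma D2_s : D2 sv0 = 6 * sv1 ∧
    D2 sv1 = 5 * sv2 ∧
    D2 sv2 = 4 * sv3 ∧
    D2 sv3 = 3 * sv4 ∧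
    D2 sv4 = 2 * sv5 ∧
    D2 sv5 = 1 * sv6 ∧
    D2 sv6 = 0 := by
  obtain ⟨hx0, hx1, hx2, hx3, hx4, hx5, hx6, hx7⟩ := D2_x
  refine ⟨?_, ?_, ?_, ?_, ?_, ?_, ?_⟩ <;>
  simp only [sv0, sv1, sv2, sv3, sv4, sv5, sv6, map_add, map_sub, Derivation.leibniz, smul_eq_mul, der_ofNat, mul_zero, zero_mul, hx0, hx1, hx2, hx3, hx4, hx5, hx6, hx7] <;> ring

lemma Ed_s : Ed sv0 = 2 * sv0 ∧
    Ed sv1 = 2 * sv1 ∧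
    Ed sv2 = 2 * sv2 ∧
    Ed sv3 = 2 * sv3 ∧
    Ed sv4 = 2 * sv4 ∧
    Ed sv5 = 2 * sv5 ∧
    Ed sv6 = 2 * sv6 := by
  obtain ⟨hx0, hx1, hx2, hx3, hx4, hx5, hx6, hx7⟩ := Ed_x
  refine ⟨?_, ?_, ?_, ?_, ?_, ?_, ?_⟩ <;>
  simp only [sv0, sv1, sv2, sv3, sv4, sv5, sv6, map_add, map_sub, Derivation.leibniz, smul_eq_mul, der_ofNat, mul_zero, zero_mul, hx0, hx1, hx2, hx3, hx4, hx5, hx6, hx7] <;> ring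

lemma D1_i : D1 iv0 = 0 ∧
    D1 iv1 = 1 * iv0 ∧
    D1 iv2 = 2 * iv1 ∧
    D1 iv3 = 3 * iv2 ∧
    D1 iv4 = 4 * iv3 := by
  obtain ⟨hs0, hs1, hs2, hs3, hs4, hs5, hs6⟩ := D1_s
  refine ⟨?_, ?_, ?_, ?_, ?_⟩ <;>
  simp only [iv0, iv1, iv2, iv3, iv4, map_add, map_sub, Derivation.leibniz, smul_eq_mul, der_ofNat, mul_zero, zero_mul, hs0, hs1, hs2, hs3, hs4, hs5, hs6] <;> ring

lemma D2_i : D2 iv0 = 4 * iv1 ∧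
    D2 iv1 = 3 * iv2 ∧
    D2 iv2 = 2 * iv3 ∧
    D2 iv3 = 1 * iv4 ∧
    D2 iv4 = 0 := by
  obtain ⟨hs0, hs1, hs2, hs3, hs4, hs5, hs6⟩ := D2_s
  refine ⟨?_, ?_, ?_, ?_, ?_⟩ <;>
  simp only [iv0, iv1, iv2, iv3, iv4, map_add, map_sub, Derivation.leibniz, smul_eq_mul, der_ofNat, mul_zero, zero_mul, hs0, hs1, hs2, hs3, hs4, hs5, hs6] <;> ring

lemma Ed_i : Ed iv0 = 4 * iv0 ∧
    Ed iv1 = 4 * iv1 ∧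
    Ed iv2 = 4 * iv2 ∧
    Ed iv3 = 4 * iv3 ∧
    Ed iv4 = 4 * iv4 := by
  obtain ⟨hs0, hs1, hs2, hs3, hs4, hs5, hs6⟩ := Ed_s
  refine ⟨?_, ?_, ?_, ?_, ?_⟩ <;>
  simp only [iv0, iv1, iv2, iv3, iv4, map_add, map_sub, Derivation.leibniz, smul_eq_mul, der_ofNat, mul_zero, zero_mul, hs0, hs1, hs2, hs3, hs4, hs5, hs6] <;> ring

lemma D1_r : D1 rv0 = 0 ∧
    D1 rv1 = 1 * rv0 ∧
    D1 rv2 = 2 * rv1 ∧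
    D1 rv3 = 3 * rv2 ∧
    D1 rv4 = 4 * rv3 := by
  obtain ⟨hq0, hq1, hq2⟩ := D1_q
  obtain ⟨hs0, hs1, hs2, hs3, hs4, hs5, hs6⟩ := D1_s
  refine ⟨?_, ?_, ?_, ?_, ?_⟩ <;>
  simp only [rv0, rv1, rv2, rv3, rv4, map_add, map_sub, Derivation.leibniz, smul_eq_mul, der_ofNat, mul_zero, zero_mul, hq0, hq1, hq2, hs0, hs1, hs2, hs3, hs4, hs5, hs6] <;> ring

lemma D2_r : D2 rv0 = 4 * rv1 ∧
    D2 rv1 = 3 * rv2 ∧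
    D2 rv2 = 2 * rv3 ∧
    D2 rv3 = 1 * rv4 ∧
    D2 rv4 = 0 := by
  obtain ⟨hq0, hq1, hq2⟩ := D2_q
  obtain ⟨hs0, hs1, hs2, hs3, hs4, hs5, hs6⟩ := D2_s
  refine ⟨?_, ?_, ?_, ?_, ?_⟩ <;>
  simp only [rv0, rv1, rv2, rv3, rv4, map_add, map_sub, Derivation.leibniz, smul_eq_mul, der_ofNat, mul_zero, zero_mul, hq0, hq1, hq2, hs0, hs1, hs2, hs3, hs4, hs5, hs6] <;> ring

lemma Ed_r : Ed rv0 = 4 * rv0 ∧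
    Ed rv1 = 4 * rv1 ∧
    Ed rv2 = 4 * rv2 ∧
    Ed rv3 = 4 * rv3 ∧
    Ed rv4 = 4 * rv4 := by
  obtain ⟨hq0, hq1, hq2⟩ := Ed_q
  obtain ⟨hs0, hs1, hs2, hs3, hs4, hs5, hs6⟩ := Ed_s
  refine ⟨?_, ?_, ?_, ?_, ?_⟩ <;>
  simp only [rv0, rv1, rv2, rv3, rv4, map_add, map_sub, Derivation.leibniz, smul_eq_mul, der_ofNat, mul_zero, zero_mul, hq0, hq1, hq2, hs0, hs1, hs2, hs3, hs4, hs5, hs6] <;> ring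

lemma D1_v : D1 vv0 = 0 ∧
    D1 vv1 = 1 * vv0 ∧
    D1 vv2 = 2 * vv1 := by
  obtain ⟨hq0, hq1, hq2⟩ := D1_q
  obtain ⟨hr0, hr1, hr2, hr3, hr4⟩ := D1_r
  refine ⟨?_, ?_, ?_⟩ <;>
  simp only [vv0, vv1, vv2, map_add, map_sub, Derivation.leibniz, smul_eq_mul, der_ofNat, mul_zero, zero_mul, hq0, hq1, hq2, hr0, hr1, hr2, hr3, hr4] <;> ring

lemma D2_v : D2 vv0 = 2 * vv1 ∧
    D2 vv1 = 1 * vv2 ∧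
    D2 vv2 = 0 := by
  obtain ⟨hq0, hq1, hq2⟩ := D2_q
  obtain ⟨hr0, hr1, hr2, hr3, hr4⟩ := D2_r
  refine ⟨?_, ?_, ?_⟩ <;>
  simp only [vv0, vv1, vv2, map_add, map_sub, Derivation.leibniz, smul_eq_mul, der_ofNat, mul_zero, zero_mul, hq0, hq1, hq2, hr0, hr1, hr2, hr3, hr4] <;> ring

lemma Ed_v : Ed vv0 = 6 * vv0 ∧
    Ed vv1 = 6 * vv1 ∧
    Ed vv2 = 6 * vv2 := by
  obtain ⟨hq0, hq1, hq2⟩ := Ed_q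
  obtain ⟨hr0, hr1, hr2, hr3, hr4⟩ := Ed_r
  refine ⟨?_, ?_, ?_⟩ <;>
  simp only [vv0, vv1, vv2, map_add, map_sub, Derivation.leibniz, smul_eq_mul, der_ofNat, mul_zero, zero_mul, hq0, hq1, hq2, hr0, hr1, hr2, hr3, hr4] <;> ring

lemma D1_invF : D1 invF = 0 := by
  obtain ⟨hq0, hq1, hq2⟩ := D1_q
  simp only [invF, map_add, map_sub, Derivation.leibniz, smul_eq_mul, der_ofNat, mul_zero, zero_mul, hq0, hq1, hq2]; ring

lemma D2_invF : D2 invF = 0 := by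
  obtain ⟨hq0, hq1, hq2⟩ := D2_q
  simp only [invF, map_add, map_sub, Derivation.leibniz, smul_eq_mul, der_ofNat, mul_zero, zero_mul, hq0, hq1, hq2]; ring

lemma Ed_invF : Ed invF = 4 * invF := by
  obtain ⟨hq0, hq1, hq2⟩ := Ed_q
  simp only [invF, map_add, map_sub, Derivation.leibniz, smul_eq_mul, der_ofNat, mul_zero, zero_mul, hq0, hq1, hq2]; ring

lemma invF_mem : invF ∈ V 4 := by
  rw [mem_V, hom_iff, Ed_invF]
  refine ⟨?_, D1_invF, D2_invF⟩
  rw [MvPolynomial.smul_eq_C_mul]; simp [C_num]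

lemma D1_invA : D1 invA = 0 := by
  obtain ⟨hq0, hq1, hq2⟩ := D1_q
  obtain ⟨hv0, hv1, hv2⟩ := D1_v
  simp only [invA, map_add, map_sub, Derivation.leibniz, smul_eq_mul, der_ofNat, mul_zero, zero_mul, hq0, hq1, hq2, hv0, hv1, hv2]; ring

lemma D2_invA : D2 invA = 0 := by
  obtain ⟨hq0, hq1, hq2⟩ := D2_q
  obtain ⟨hv0, hv1, hv2⟩ := D2_v
  simp only [invA, map_add, map_sub, Derivation.leibniz, smul_eq_mul, der_ofNat, mul_zero, zero_mul, hq0, hq1, hq2, hv0, hv1, hv2]; ring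

lemma Ed_invA : Ed invA = 8 * invA := by
  obtain ⟨hq0, hq1, hq2⟩ := Ed_q
  obtain ⟨hv0, hv1, hv2⟩ := Ed_v
  simp only [invA, map_add, map_sub, Derivation.leibniz, smul_eq_mul, der_ofNat, mul_zero, zero_mul, hq0, hq1, hq2, hv0, hv1, hv2]; ring

lemma invA_mem : invA ∈ V 8 := by
  rw [mem_V, hom_iff, Ed_invA]
  refine ⟨?_, D1_invA, D2_invA⟩
  rw [MvPolynomial.smul_eq_C_mul]; simp [C_num]

lemma D1_invB : D1 invB = 0 := by
  obtain ⟨hr0, hr1, hr2, hr3, hr4⟩ := D1_r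
  simp only [invB, map_add, map_sub, Derivation.leibniz, smul_eq_mul, der_ofNat, mul_zero, zero_mul, hr0, hr1, hr2, hr3, hr4]; ring

lemma D2_invB : D2 invB = 0 := by
  obtain ⟨hr0, hr1, hr2, hr3, hr4⟩ := D2_r
  simp only [invB, map_add, map_sub, Derivation.leibniz, smul_eq_mul, der_ofNat, mul_zero, zero_mul, hr0, hr1, hr2, hr3, hr4]; ring

lemma Ed_invB : Ed invB = 8 * invB := by
  obtain ⟨hr0, hr1, hr2, hr3, hr4⟩ := Ed_r
  simp only [invB, map_add, map_sub, Derivation.leibniz, smul_eq_mul, der_ofNat, mul_zero, zero_mul, hr0, hr1, hr2, hr3, hr4]; ring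

lemma invB_mem : invB ∈ V 8 := by
  rw [mem_V, hom_iff, Ed_invB]
  refine ⟨?_, D1_invB, D2_invB⟩
  rw [MvPolynomial.smul_eq_C_mul]; simp [C_num]

lemma D1_invC : D1 invC = 0 := by
  obtain ⟨hi0, hi1, hi2, hi3, hi4⟩ := D1_i
  obtain ⟨hr0, hr1, hr2, hr3, hr4⟩ := D1_r
  simp only [invC, map_add, map_sub, Derivation.leibniz, smul_eq_mul, der_ofNat, mul_zero, zero_mul, hi0, hi1, hi2, hi3, hi4, hr0, hr1, hr2, hr3, hr4]; ring

lemma D2_invC : D2 invC = 0 := by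
  obtain ⟨hi0, hi1, hi2, hi3, hi4⟩ := D2_i
  obtain ⟨hr0, hr1, hr2, hr3, hr4⟩ := D2_r
  simp only [invC, map_add, map_sub, Derivation.leibniz, smul_eq_mul, der_ofNat, mul_zero, zero_mul, hi0, hi1, hi2, hi3, hi4, hr0, hr1, hr2, hr3, hr4]; ring

lemma Ed_invC : Ed invC = 8 * invC := by
  obtain ⟨hi0, hi1, hi2, hi3, hi4⟩ := Ed_i
  obtain ⟨hr0, hr1, hr2, hr3, hr4⟩ := Ed_r
  simp only [invC, map_add, map_sub, Derivation.leibniz, smul_eq_mul, der_ofNat, mul_zero, zero_mul, hi0, hi1, hi2, hi3, hi4, hr0, hr1, hr2, hr3, hr4]; ring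

lemma invC_mem : invC ∈ V 8 := by
  rw [mem_V, hom_iff, Ed_invC]
  refine ⟨?_, D1_invC, D2_invC⟩
  rw [MvPolynomial.smul_eq_C_mul]; simp [C_num]

def pt1 : Fin 8 → ℂ := ![0, 0, 0, 1, 0, 0, 0, 1]

lemma pt1_inv : eval pt1 invF = 0 ∧ eval pt1 invA = -160000 ∧ eval pt1 invB = 160000 ∧ eval pt1 invC = -3840000 := by
  obtain ⟨h0, h1, h2, h3, h4, h5, h6, h7⟩ : pt1 0 = 0 ∧ pt1 1 = 0 ∧ pt1 2 = 0 ∧ pt1 3 = 1 ∧ pt1 4 = 0 ∧ pt1 5 = 0 ∧ pt1 6 = 0 ∧ pt1 7 = 1 := by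
    refine ⟨?_, ?_, ?_, ?_, ?_, ?_, ?_, ?_⟩ <;> rfl
  refine ⟨?_, ?_, ?_, ?_⟩ <;> norm_num [invF, invA, invB, invC, vv0, vv1, vv2, iv0, iv1, iv2, iv3, iv4,
    rv0, rv1, rv2, rv3, rv4, qv0, qv1, qv2, sv0, sv1, sv2, sv3, sv4, sv5, sv6, h0, h1, h2, h3, h4, h5, h6, h7]

def pt2 : Fin 8 → ℂ := ![0, 0, 1, 1, 0, 0, 0, 1]

lemma pt2_inv : eval pt2 invF = 0 ∧ eval pt2 invA = -160000 ∧ eval pt2 invB = 160000 ∧ eval pt2 invC = -2400000 := by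
  obtain ⟨h0, h1, h2, h3, h4, h5, h6, h7⟩ : pt2 0 = 0 ∧ pt2 1 = 0 ∧ pt2 2 = 1 ∧ pt2 3 = 1 ∧ pt2 4 = 0 ∧ pt2 5 = 0 ∧ pt2 6 = 0 ∧ pt2 7 = 1 := by
    refine ⟨?_, ?_, ?_, ?_, ?_, ?_, ?_, ?_⟩ <;> rfl
  refine ⟨?_, ?_, ?_, ?_⟩ <;> norm_num [invF, invA, invB, invC, vv0, vv1, vv2, iv0, iv1, iv2, iv3, iv4,
    rv0, rv1, rv2, rv3, rv4, qv0, qv1, qv2, sv0, sv1, sv2, sv3, sv4, sv5, sv6, h0, h1, h2, h3, h4, h5, h6, h7]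

def pt3 : Fin 8 → ℂ := ![0, 0, 1, -1, 0, 0, 0, 1]

lemma pt3_inv : eval pt3 invF = 0 ∧ eval pt3 invA = 160000 ∧ eval pt3 invB = -160000 ∧ eval pt3 invC = 5280000 := by
  obtain ⟨h0, h1, h2, h3, h4, h5, h6, h7⟩ : pt3 0 = 0 ∧ pt3 1 = 0 ∧ pt3 2 = 1 ∧ pt3 3 = -1 ∧ pt3 4 = 0 ∧ pt3 5 = 0 ∧ pt3 6 = 0 ∧ pt3 7 = 1 := by
    refine ⟨?_, ?_, ?_, ?_, ?_, ?_, ?_, ?_⟩ <;> rfl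
  refine ⟨?_, ?_, ?_, ?_⟩ <;> norm_num [invF, invA, invB, invC, vv0, vv1, vv2, iv0, iv1, iv2, iv3, iv4,
    rv0, rv1, rv2, rv3, rv4, qv0, qv1, qv2, sv0, sv1, sv2, sv3, sv4, sv5, sv6, h0, h1, h2, h3, h4, h5, h6, h7]

def pt4 : Fin 8 → ℂ := ![5, -5, 0, 1, 1, 1, 0, 1]

lemma pt4_inv : eval pt4 invF = 0 ∧ eval pt4 invA = 5120000 ∧ eval pt4 invB = 4480000 ∧ eval pt4 invC = -971520000 := by
  obtain ⟨h0, h1, h2, h3, h4, h5, h6, h7⟩ : pt4 0 = 5 ∧ pt4 1 = -5 ∧ pt4 2 = 0 ∧ pt4 3 = 1 ∧ pt4 4 = 1 ∧ pt4 5 = 1 ∧ pt4 6 = 0 ∧ pt4 7 = 1 := by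
    refine ⟨?_, ?_, ?_, ?_, ?_, ?_, ?_, ?_⟩ <;> rfl
  refine ⟨?_, ?_, ?_, ?_⟩ <;> norm_num [invF, invA, invB, invC, vv0, vv1, vv2, iv0, iv1, iv2, iv3, iv4,
    rv0, rv1, rv2, rv3, rv4, qv0, qv1, qv2, sv0, sv1, sv2, sv3, sv4, sv5, sv6, h0, h1, h2, h3, h4, h5, h6, h7]

def pt5 : Fin 8 → ℂ := ![-5, -5, 0, -1, 1, -1, 0, 1]

lemma pt5_inv : eval pt5 invF = 0 ∧ eval pt5 invA = -20480000 ∧ eval pt5 invB = -2560000 ∧ eval pt5 invC = -1251840000 := by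
  obtain ⟨h0, h1, h2, h3, h4, h5, h6, h7⟩ : pt5 0 = -5 ∧ pt5 1 = -5 ∧ pt5 2 = 0 ∧ pt5 3 = -1 ∧ pt5 4 = 1 ∧ pt5 5 = -1 ∧ pt5 6 = 0 ∧ pt5 7 = 1 := by
    refine ⟨?_, ?_, ?_, ?_, ?_, ?_, ?_, ?_⟩ <;> rfl
  refine ⟨?_, ?_, ?_, ?_⟩ <;> norm_num [invF, invA, invB, invC, vv0, vv1, vv2, iv0, iv1, iv2, iv3, iv4,
    rv0, rv1, rv2, rv3, rv4, qv0, qv1, qv2, sv0, sv1, sv2, sv3, sv4, sv5, sv6, h0, h1, h2, h3, h4, h5, h6, h7]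

def pt6 : Fin 8 → ℂ := ![-4, -5, 1, 1, 1, 1, 0, 1]

lemma pt6_inv : eval pt6 invF = 0 ∧ eval pt6 invA = 27440000 ∧ eval pt6 invB = 19600000 ∧ eval pt6 invC = -697200000 := by
  obtain ⟨h0, h1, h2, h3, h4, h5, h6, h7⟩ : pt6 0 = -4 ∧ pt6 1 = -5 ∧ pt6 2 = 1 ∧ pt6 3 = 1 ∧ pt6 4 = 1 ∧ pt6 5 = 1 ∧ pt6 6 = 0 ∧ pt6 7 = 1 := by
    refine ⟨?_, ?_, ?_, ?_, ?_, ?_, ?_, ?_⟩ <;> rfl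
  refine ⟨?_, ?_, ?_, ?_⟩ <;> norm_num [invF, invA, invB, invC, vv0, vv1, vv2, iv0, iv1, iv2, iv3, iv4,
    rv0, rv1, rv2, rv3, rv4, qv0, qv1, qv2, sv0, sv1, sv2, sv3, sv4, sv5, sv6, h0, h1, h2, h3, h4, h5, h6, h7]

/-! ### Main argument -/

lemma invF_ne : invF ≠ 0 := by
  intro h
  have h0 := congrArg (eval (fun i : Fin 8 => if i = 0 ∨ i = 7 then (1 : ℂ) else 0)) h
  simp [invF, qv0, qv1, qv2] at h0

lemma indep3 {c0 c1 c2 c3 : ℂ}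
    (h : c0 • (invF * invF) + c1 • invA + c2 • invB + c3 • invC = 0) :
    c0 = 0 ∧ c1 = 0 ∧ c2 = 0 ∧ c3 = 0 := by
  have e1 := congrArg (eval pt1) h
  have e2 := congrArg (eval pt2) h
  have e4 := congrArg (eval pt4) h
  obtain ⟨f1, a1, b1, k1⟩ := pt1_inv
  obtain ⟨f2, a2, b2, k2⟩ := pt2_inv
  obtain ⟨f4, a4, b4, k4⟩ := pt4_inv
  simp only [map_add, map_mul, smul_eval, map_zero, f1, a1, b1, k1, f2, a2, b2, k2, f4, a4, b4,
    k4] at e1 e2 e4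
  have h3 : c3 = 0 := by linear_combination (e2 - e1) / 1440000
  have h1 : c1 = 0 := by
    subst h3
    linear_combination (e4 - 28 * e1) / 9600000
  have h2 : c2 = 0 := by
    subst h3; subst h1
    linear_combination e1 / 160000
  subst h1; subst h2; subst h3
  refine ⟨?_, rfl, rfl, rfl⟩
  simpa [invF_ne] using h

lemma indep6 {g : MvPolynomial (Fin 8) ℂ} {x1 x2 x3 x4 x5 x6 : ℂ}
    (h : invF * g + (x1 • (invA * invA) + x2 • (invA * invB) + x3 • (invA * invC) +
      x4 • (invB * invB) + x5 • (invB * invC) + x6 • (invC * invC)) = 0) :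
    g = 0 ∧ x1 = 0 ∧ x2 = 0 ∧ x3 = 0 ∧ x4 = 0 ∧ x5 = 0 ∧ x6 = 0 := by
  have e1 := congrArg (eval pt1) h
  have e2 := congrArg (eval pt2) h
  have e3 := congrArg (eval pt3) h
  have e4 := congrArg (eval pt4) h
  have e5 := congrArg (eval pt5) h
  have e6 := congrArg (eval pt6) h
  obtain ⟨f1, a1, b1, k1⟩ := pt1_inv
  obtain ⟨f2, a2, b2, k2⟩ := pt2_inv
  obtain ⟨f3, a3, b3, k3⟩ := pt3_inv
  obtain ⟨f4, a4, b4, k4⟩ := pt4_inv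
  obtain ⟨f5, a5, b5, k5⟩ := pt5_inv
  obtain ⟨f6, a6, b6, k6⟩ := pt6_inv
  simp only [map_add, map_mul, smul_eval, map_zero, f1, a1, b1, k1] at e1
  simp only [map_add, map_mul, smul_eval, map_zero, f2, a2, b2, k2] at e2
  simp only [map_add, map_mul, smul_eval, map_zero, f3, a3, b3, k3] at e3
  simp only [map_add, map_mul, smul_eval, map_zero, f4, a4, b4, k4] at e4
  simp only [map_add, map_mul, smul_eval, map_zero, f5, a5, b5, k5] at e5
  simp only [map_add, map_mul, smul_eval, map_zero, f6, a6, b6, k6] at e6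
  clear f1 a1 b1 k1 f2 a2 b2 k2 f3 a3 b3 k3 f4 a4 b4 k4 f5 a5 b5 k5 f6 a6 b6 k6
  have h1 : x1 = 0 := by linear_combination (3169093/485503200000000)*e1 + (-13235737/4142960640000000)*e2 + (-1725343/517870080000000)*e3 + (17/1479628800000000)*e4 + (329/113635491840000000)*e5 + (-61/84585446400000000)*e6
  have h2 : x2 = 0 := by linear_combination (-159571/34944000000000)*e1 + (186049/83865600000000)*e2 + (48887/20966400000000)*e3 + (-7/718848000000000)*e4 + (-1/766771200000000)*e5 + (1/616412160000000)*e6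
  have h3 : x3 = 0 := by linear_combination (-12880849/233041536000000000)*e1 + (103021/3884025600000000)*e2 + (446783/15536102400000000)*e3 + (-77/532666368000000000)*e4 + (-7/1704532377600000000)*e5 + (1/142737940800000000)*e6
  have h4 : x4 = 0 := by linear_combination (-440162369/38840256000000000)*e1 + (5804437/1035740160000000)*e2 + (29778059/5178700800000000)*e3 + (-3769/177555456000000000)*e4 + (-1193/284088729600000000)*e5 + (223/95158627200000000)*e6
  have h5 : x5 = 0 := by linear_combination (-18275329/233041536000000000)*e1 + (417077/10357401600000000)*e2 + (1185767/31072204800000000)*e3 + (-77/532666368000000000)*e4 + (-7/1704532377600000000)*e5 + (1/142737940800000000)*e6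
  have h6 : x6 = 0 := by linear_combination (-1/2073600000000)*e1 + (1/4147200000000)*e2 + (1/4147200000000)*e3
  subst h1; subst h2; subst h3; subst h4; subst h5; subst h6
  refine ⟨?_, rfl, rfl, rfl, rfl, rfl, rfl⟩
  simpa [invF_ne] using h

lemma V_mul {a b n : ℕ} (hab : a + b = n) {g h : MvPolynomial (Fin 8) ℂ} (hg : g ∈ V a)
    (hh : h ∈ V b) : g * h ∈ V n := by
  subst hab
  rw [mem_V] at *
  refine ⟨hg.1.mul hh.1, ?_, ?_⟩
  · rw [Derivation.leibniz, hg.2.1, hh.2.1]; simp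
  · rw [Derivation.leibniz, hg.2.2, hh.2.2]; simp

lemma W_le {n : ℕ} {S : Submodule ℂ (MvPolynomial (Fin 8) ℂ)}
    (H : ∀ a b, 0 < a → 0 < b → a + b = n → ∀ g ∈ V a, ∀ h ∈ V b, g * h ∈ S) : W n ≤ S := by
  refine Submodule.span_le.2 ?_
  rintro p ⟨g, h, a, b, ha, hb, hab, h1, h2, h3, h4, h5, h6, rfl⟩
  exact H a b ha hb hab g (mem_V.2 ⟨h1, h3, h4⟩) h (mem_V.2 ⟨h2, h5, h6⟩)

lemma mul_mem_W {a b n : ℕ} (ha : 0 < a) (hb : 0 < b) (hab : a + b = n)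
    {g h : MvPolynomial (Fin 8) ℂ} (hg : g ∈ V a) (hh : h ∈ V b) : g * h ∈ W n := by
  rw [mem_V] at *
  exact Submodule.subset_span
    ⟨g, h, a, b, ha, hb, hab, hg.1, hh.1, hg.2.1, hg.2.2, hh.2.1, hh.2.2, rfl⟩

lemma W_le_V (n : ℕ) : W n ≤ V n :=
  W_le fun a b _ _ hab g hg h hh => V_mul hab hg hh

lemma FF_mem : invF * invF ∈ V 8 := V_mul (by norm_num) invF_mem invF_mem

attribute [irreducible] invF invA invB invC

lemma delta_eq {n d k : ℕ} (hfin : FiniteDimensional ℂ (V n)) (hV : Module.finrank ℂ (V n) = d + k)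
    (hW : Module.finrank ℂ (W n) = k) : delta n = d := by
  have h1 := Submodule.finrank_quotient_add_finrank (Submodule.comap (V n).subtype (W n))
  rw [(Submodule.comapSubtypeEquivOfLe (W_le_V n)).finrank_eq, hV, hW] at h1
  unfold delta
  omega

lemma fV {n w : ℕ} (hw : 2 * (w + 1) = 7 * n) {d e : ℕ} (h1 : cnt 6 n w = e)
    (h2 : cnt 6 n (w + 1) = d + e) :
    FiniteDimensional ℂ (V n) ∧ Module.finrank ℂ (V n) = d := by
  obtain ⟨h, h'⟩ := finrank_V n w hw
  exact ⟨h, by omega⟩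

lemma dims : (FiniteDimensional ℂ (V 2) ∧ Module.finrank ℂ (V 2) = 0) ∧
    (FiniteDimensional ℂ (V 4) ∧ Module.finrank ℂ (V 4) = 1) ∧
    (FiniteDimensional ℂ (V 6) ∧ Module.finrank ℂ (V 6) = 0) ∧
    (FiniteDimensional ℂ (V 8) ∧ Module.finrank ℂ (V 8) = 4) ∧
    (FiniteDimensional ℂ (V 10) ∧ Module.finrank ℂ (V 10) = 0) ∧
    (FiniteDimensional ℂ (V 12) ∧ Module.finrank ℂ (V 12) = 10) ∧
    (FiniteDimensional ℂ (V 14) ∧ Module.finrank ℂ (V 14) = 4) ∧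
    (FiniteDimensional ℂ (V 16) ∧ Module.finrank ℂ (V 16) = 18) ∧
    (FiniteDimensional ℂ (V 18) ∧ Module.finrank ℂ (V 18) = 13) := by
  obtain ⟨⟨a1, b1⟩, ⟨a2, b2⟩, ⟨a3, b3⟩, ⟨a4, b4⟩, ⟨a5, b5⟩, ⟨a6, b6⟩, ⟨a7, b7⟩, ⟨a8, b8⟩,
    ⟨a9, b9⟩⟩ := cnt_vals
  exact ⟨fV (by norm_num) b1 a1, fV (by norm_num) b2 a2, fV (by norm_num) b3 a3,
    fV (by norm_num) b4 a4, fV (by norm_num) b5 a5, fV (by norm_num) b6 a6,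
    fV (by norm_num) b7 a7, fV (by norm_num) b8 a8, fV (by norm_num) b9 a9⟩

lemma eq_zero_of_finrank {n : ℕ} (h : FiniteDimensional ℂ (V n) ∧ Module.finrank ℂ (V n) = 0)
    {p : MvPolynomial (Fin 8) ℂ} (hp : p ∈ V n) : p = 0 := by
  obtain ⟨h1, h2⟩ := h
  rw [Submodule.finrank_eq_zero] at h2
  rwa [h2, Submodule.mem_bot] at hp

def bad (k : ℕ) : Prop := k % 2 = 1 ∨ k = 2 ∨ k = 6 ∨ k = 10

lemma V_bad {k : ℕ} (hk : bad k) {p : MvPolynomial (Fin 8) ℂ} (hp : p ∈ V k) : p = 0 := by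
  rcases hk with h | rfl | rfl | rfl
  · exact V_odd h hp
  · exact eq_zero_of_finrank dims.1 hp
  · exact eq_zero_of_finrank dims.2.2.1 hp
  · exact eq_zero_of_finrank dims.2.2.2.2.1 hp

lemma V4 {g : MvPolynomial (Fin 8) ℂ} (hg : g ∈ V 4) : ∃ c : ℂ, c • invF = g := by
  have h := (finrank_eq_one_iff_of_nonzero' (⟨invF, invF_mem⟩ : V 4)
    (fun h => invF_ne (congrArg Subtype.val h))).1 dims.2.1.2 ⟨g, hg⟩
  obtain ⟨c, hc⟩ := h
  exact ⟨c, congrArg Subtype.val hc⟩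

lemma V8 {g : MvPolynomial (Fin 8) ℂ} (hg : g ∈ V 8) : ∃ c0 c1 c2 c3 : ℂ,
    g = c0 • (invF * invF) + c1 • invA + c2 • invB + c3 • invC := by
  have := dims.2.2.2.1.1
  let v : Fin 4 → V 8 := ![⟨invF * invF, FF_mem⟩, ⟨invA, invA_mem⟩,
    ⟨invB, invB_mem⟩, ⟨invC, invC_mem⟩]
  have hv : LinearIndependent ℂ v := by
    rw [Fintype.linearIndependent_iff]
    intro c hc
    have h := congrArg Subtype.val hc
    simp only [Fin.sum_univ_four] at h
    obtain ⟨h0, h1, h2, h3⟩ := indep3 h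
    intro i
    fin_cases i <;> assumption
  have hs := hv.span_eq_top_of_card_eq_finrank (by rw [dims.2.2.2.1.2]; simp)
  have hm : (⟨g, hg⟩ : V 8) ∈ Submodule.span ℂ (Set.range v) := by rw [hs]; trivial
  rw [Submodule.mem_span_range_iff_exists_fun] at hm
  obtain ⟨c, hc⟩ := hm
  have h := congrArg Subtype.val hc
  simp only [Fin.sum_univ_four] at h
  exact ⟨c 0, c 1, c 2, c 3, h.symm⟩

lemma mulF_inj : Function.Injective (LinearMap.mulLeft ℂ invF) :=
  fun _ _ h => mul_left_cancel₀ invF_ne h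

lemma W_bot {n : ℕ} (H : ∀ a b, 0 < a → 0 < b → a + b = n → bad a ∨ bad b) :
    Module.finrank ℂ (W n) = 0 := by
  have : W n = ⊥ := by
    rw [eq_bot_iff]
    refine W_le fun a b ha hb hab g hg h hh => ?_
    rw [Submodule.mem_bot]
    rcases H a b ha hb hab with h1 | h1
    · rw [V_bad h1 hg, zero_mul]
    · rw [V_bad h1 hh, mul_zero]
  rw [this, finrank_bot]

lemma W_F {n m : ℕ} (hm : 0 < m) (hn : 4 + m = n)
    (H : ∀ a b, 0 < a → 0 < b → a + b = n → bad a ∨ bad b ∨ a = 4 ∨ b = 4) :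
    Module.finrank ℂ (W n) = Module.finrank ℂ (V m) := by
  have : W n = (V m).map (LinearMap.mulLeft ℂ invF) := by
    apply le_antisymm
    · refine W_le fun a b ha hb hab g hg h hh => ?_
      rcases H a b ha hb hab with h1 | h1 | rfl | rfl
      · rw [V_bad h1 hg, zero_mul]; exact Submodule.zero_mem _
      · rw [V_bad h1 hh, mul_zero]; exact Submodule.zero_mem _
      · obtain ⟨c, rfl⟩ := V4 hg
        obtain rfl : b = m := by omega
        exact ⟨c • h, Submodule.smul_mem _ _ hh, by simp⟩
      · obtain ⟨c, rfl⟩ := V4 hh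
        obtain rfl : a = m := by omega
        exact ⟨c • g, Submodule.smul_mem _ _ hg, by simp [mul_comm]⟩
    · rintro _ ⟨g, hg, rfl⟩
      exact mul_mem_W (by norm_num) hm hn invF_mem hg
  rw [this]
  exact (Submodule.equivMapOfInjective _ mulF_inj (V m)).finrank_eq.symm

lemma prod_expand (F A B C : MvPolynomial (Fin 8) ℂ) (c0 c1 c2 c3 d0 d1 d2 d3 : ℂ) :
    F * (F * ((c0 * d0) • (F * F) + (c0 * d1 + c1 * d0) • A +
      (c0 * d2 + c2 * d0) • B + (c0 * d3 + c3 * d0) • C)) + ((c1 * d1) • (A * A) +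
      (c1 * d2 + c2 * d1) • (A * B) + (c1 * d3 + c3 * d1) • (A * C) +
      (c2 * d2) • (B * B) + (c2 * d3 + c3 * d2) • (B * C) + (c3 * d3) • (C * C)) =
    (c0 • (F * F) + c1 • A + c2 • B + c3 • C) * (d0 • (F * F) + d1 • A + d2 • B + d3 • C) := by
  simp only [MvPolynomial.smul_eq_C_mul, map_add, map_mul]
  ring

lemma W16 : Module.finrank ℂ (W 16) = 16 := by
  have := dims.2.2.2.2.2.1.1
  let v : Fin 6 → MvPolynomial (Fin 8) ℂ := ![invA * invA, invA * invB, invA * invC,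
    invB * invB, invB * invC, invC * invC]
  let Φ : (V 12 × (Fin 6 → ℂ)) →ₗ[ℂ] MvPolynomial (Fin 8) ℂ :=
    (LinearMap.mulLeft ℂ invF ∘ₗ (V 12).subtype).coprod (Fintype.linearCombination ℂ v)
  have hΦ : ∀ g c, Φ (g, c) = invF * (g : MvPolynomial (Fin 8) ℂ) + (c 0 • (invA * invA) +
      c 1 • (invA * invB) + c 2 • (invA * invC) +
      c 3 • (invB * invB) + c 4 • (invB * invC) + c 5 • (invC * invC)) := by
    intro g c
    simp only [Φ, LinearMap.coprod_apply, Fintype.linearCombination_apply, Fin.sum_univ_six]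
    rfl
  have hinj : Function.Injective Φ := by
    rw [← LinearMap.ker_eq_bot, LinearMap.ker_eq_bot']
    rintro ⟨g, c⟩ h
    rw [hΦ] at h
    obtain ⟨h0, h1, h2, h3, h4, h5, h6⟩ := indep6 h
    ext1
    · exact Subtype.ext h0
    · funext i
      fin_cases i <;> assumption
  have hr : W 16 = LinearMap.range Φ := by
    apply le_antisymm
    · refine W_le fun a b ha hb hab g hg h hh => ?_
      have H : bad a ∨ bad b ∨ (a = 4 ∧ b = 12) ∨ (b = 4 ∧ a = 12) ∨ (a = 8 ∧ b = 8) := by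
        unfold bad; omega
      rcases H with h1 | h1 | ⟨rfl, rfl⟩ | ⟨rfl, rfl⟩ | ⟨rfl, rfl⟩
      · rw [V_bad h1 hg, zero_mul]; exact Submodule.zero_mem _
      · rw [V_bad h1 hh, mul_zero]; exact Submodule.zero_mem _
      · obtain ⟨c, rfl⟩ := V4 hg
        refine ⟨(⟨c • h, Submodule.smul_mem _ _ hh⟩, 0), ?_⟩
        rw [hΦ]; simp
      · obtain ⟨c, rfl⟩ := V4 hh
        refine ⟨(⟨c • g, Submodule.smul_mem _ _ hg⟩, 0), ?_⟩
        rw [hΦ]; simp [mul_comm]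
      · obtain ⟨c0, c1, c2, c3, rfl⟩ := V8 hg
        obtain ⟨d0, d1, d2, d3, rfl⟩ := V8 hh
        have hmem : invF * ((c0 * d0) • (invF * invF) + (c0 * d1 + c1 * d0) • invA +
            (c0 * d2 + c2 * d0) • invB + (c0 * d3 + c3 * d0) • invC) ∈ V 12 := by
          refine V_mul (a := 4) (b := 8) (by norm_num) invF_mem ?_
          exact add_mem (add_mem (add_mem (Submodule.smul_mem _ _ FF_mem)
            (Submodule.smul_mem _ _ invA_mem)) (Submodule.smul_mem _ _ invB_mem))
            (Submodule.smul_mem _ _ invC_mem)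
        refine ⟨(⟨_, hmem⟩, ![c1 * d1, c1 * d2 + c2 * d1, c1 * d3 + c3 * d1, c2 * d2,
          c2 * d3 + c3 * d2, c3 * d3]), ?_⟩
        rw [hΦ]
        exact prod_expand _ _ _ _ _ _ _ _ _ _ _ _
    · rintro _ ⟨⟨g, c⟩, rfl⟩
      rw [hΦ]
      have A8 := invA_mem
      have B8 := invB_mem
      have C8 := invC_mem
      have P : ∀ {g h}, g ∈ V 8 → h ∈ V 8 → g * h ∈ W 16 := fun hg hh =>
        mul_mem_W (by norm_num) (by norm_num) (by norm_num) hg hh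
      refine add_mem (mul_mem_W (by norm_num) (by norm_num) (by norm_num) invF_mem g.2) ?_
      exact add_mem (add_mem (add_mem (add_mem (add_mem
        (Submodule.smul_mem _ _ (P A8 A8)) (Submodule.smul_mem _ _ (P A8 B8)))
        (Submodule.smul_mem _ _ (P A8 C8))) (Submodule.smul_mem _ _ (P B8 B8)))
        (Submodule.smul_mem _ _ (P B8 C8))) (Submodule.smul_mem _ _ (P C8 C8))
  rw [hr, LinearMap.finrank_range_of_inj hinj, Module.finrank_prod, dims.2.2.2.2.2.1.2]
  simp

/-- The numbers `δ_n = dim_ℂ(V_n / W_n)` of irreducible invariants of the binary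
septimic in low degrees: `δ₄ = 1`, `δ₈ = 3`, `δ₁₂ = 6`, `δ₁₄ = 4`, `δ₁₆ = 2`, `δ₁₈ = 9`. -/
theorem delta_low_degrees :
    delta 4 = 1 ∧ delta 8 = 3 ∧ delta 12 = 6 ∧ delta 14 = 4 ∧ delta 16 = 2 ∧
      delta 18 = 9 := by
  obtain ⟨_, d4, _, d8, _, d12, d14, d16, d18⟩ := dims
  refine ⟨delta_eq (k := 0) d4.1 d4.2 (W_bot ?_), delta_eq (k := 1) d8.1 d8.2 ?_,
    delta_eq (k := 4) d12.1 d12.2 ?_, delta_eq (k := 0) d14.1 d14.2 (W_bot ?_),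
    delta_eq (k := 16) d16.1 d16.2 W16, delta_eq (k := 4) d18.1 d18.2 ?_⟩
  · unfold bad; omega
  · rw [W_F (m := 4) (by norm_num) (by norm_num) (by unfold bad; omega), d4.2]
  · rw [W_F (m := 8) (by norm_num) (by norm_num) (by unfold bad; omega), d8.2]
  · unfold bad; omega
  · rw [W_F (m := 14) (by norm_num) (by norm_num) (by unfold bad; omega), d14.2]
end

section
/- For the invariant algebra of the binary septimic there is, up to lower-degree invariants, exactly one new irreducible invariant in each of the degrees 20 and 26: δ_20 = dim_ℂ(V_20 / W_20) = 1 and δ_26 = dim_ℂ(V_26 / W_26) = 1. -/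
open MvPolynomial Finset

namespace Septic

abbrev A := MvPolynomial (Fin 8) ℂ

theorem der_num (D : Derivation ℂ A A) :
    D (2 : A) = 0 ∧ D (3 : A) = 0 ∧ D (4 : A) = 0 ∧ D (5 : A) = 0 ∧ D (6 : A) = 0 ∧
      D (7 : A) = 0 :=
  ⟨D.map_natCast 2, D.map_natCast 3, D.map_natCast 4, D.map_natCast 5, D.map_natCast 6,
    D.map_natCast 7⟩

noncomputable def diagD (c : Fin 8 → ℂ) : Derivation ℂ A A :=
  MvPolynomial.mkDerivation ℂ (fun i => MvPolynomial.C (c i) * MvPolynomial.X i)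

theorem diagD_X (c : Fin 8 → ℂ) (i : Fin 8) :
    diagD c (MvPolynomial.X i) = MvPolynomial.C (c i) * MvPolynomial.X i := by
  simp [diagD]

theorem diagD_monomial (c : Fin 8 → ℂ) (s : Fin 8 →₀ ℕ) (r : ℂ) :
    diagD c (MvPolynomial.monomial s r) =
      MvPolynomial.monomial s ((∑ i, (s i : ℂ) * c i) * r) := by
  rw [diagD, MvPolynomial.mkDerivation_monomial, Finsupp.sum_fintype _ _ (by simp)]
  rw [Finset.sum_mul, Finset.smul_sum, map_sum]
  refine Finset.sum_congr rfl fun i _ => ?_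
  rw [smul_eq_mul, MvPolynomial.C_mul_X_eq_monomial, MvPolynomial.monomial_mul,
    MvPolynomial.smul_monomial]
  by_cases h : s i = 0
  · simp [h]
  · rw [tsub_add_cancel_of_le]
    · congr 1; simp; ring
    · rw [Finsupp.single_le_iff]; omega

theorem coeff_diagD (c : Fin 8 → ℂ) (s : Fin 8 →₀ ℕ) (f : A) :
    (diagD c f).coeff s = (∑ i, (s i : ℂ) * c i) * f.coeff s := by
  classical
  induction f using MvPolynomial.induction_on' with
  | monomial u a =>
    rw [diagD_monomial, MvPolynomial.coeff_monomial, MvPolynomial.coeff_monomial]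
    split_ifs with h
    · rw [h]
    · simp
  | add p q hp hq => rw [map_add, MvPolynomial.coeff_add, hp, hq, MvPolynomial.coeff_add]; ring

/-- degree operator -/
noncomputable def Eu : Derivation ℂ A A := diagD (fun _ => 1)
/-- weight operator -/
noncomputable def Wt : Derivation ℂ A A := diagD (fun i => (i : ℕ))

theorem comm_Eu_D1 (f : A) : Eu (D1 f) = D1 (Eu f) := by
  have h : ⁅Eu, D1⁆ = 0 := by
    apply MvPolynomial.derivation_ext
    intro i
    rw [Derivation.commutator_apply]
    fin_cases i <;> simp [der_num, Eu, D1, diagD]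
  have := congrArg (fun D => D f) h
  simp only [Derivation.commutator_apply, Derivation.zero_apply] at this
  exact sub_eq_zero.mp this

theorem comm_Eu_D2 (f : A) : Eu (D2 f) = D2 (Eu f) := by
  have h : ⁅Eu, D2⁆ = 0 := by
    apply MvPolynomial.derivation_ext
    intro i
    rw [Derivation.commutator_apply]
    fin_cases i <;> simp [der_num, Eu, D2, diagD]
  have := congrArg (fun D => D f) h
  simp only [Derivation.commutator_apply, Derivation.zero_apply] at this
  exact sub_eq_zero.mp this

theorem comm_Wt_D1 (f : A) : Wt (D1 f) = D1 (Wt f) - D1 f := by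
  have h : ⁅Wt, D1⁆ = - D1 := by
    apply MvPolynomial.derivation_ext
    intro i
    rw [Derivation.commutator_apply]
    fin_cases i <;> simp [der_num, Wt, D1, diagD] <;> ring
  have := congrArg (fun D => D f) h
  simp only [Derivation.commutator_apply, Derivation.neg_apply] at this
  linear_combination this

theorem comm_Wt_D2 (f : A) : Wt (D2 f) = D2 (Wt f) + D2 f := by
  have h : ⁅Wt, D2⁆ = D2 := by
    apply MvPolynomial.derivation_ext
    intro i
    rw [Derivation.commutator_apply]
    fin_cases i <;> simp [der_num, Wt, D2, diagD] <;> ring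
  have := congrArg (fun D => D f) h
  simp only [Derivation.commutator_apply] at this
  linear_combination this

theorem comm_D1_D2 (f : A) : D1 (D2 f) = D2 (D1 f) + ((7:ℂ) • Eu f - (2:ℂ) • Wt f) := by
  have h : ⁅D1, D2⁆ = (7:ℂ) • Eu - (2:ℂ) • Wt := by
    apply MvPolynomial.derivation_ext
    intro i
    rw [Derivation.commutator_apply]
    fin_cases i <;> simp [der_num, Eu, Wt, D1, D2, diagD, MvPolynomial.smul_eq_C_mul,
      show (MvPolynomial.C (7:ℂ) : A) = 7 from rfl, show (MvPolynomial.C (2:ℂ) : A) = 2 from rfl] <;> ring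
  have := congrArg (fun D => D f) h
  simp only [Derivation.commutator_apply, Derivation.sub_apply, Derivation.smul_apply] at this
  linear_combination this

/-- exponents of degree `n` and weight `w` -/
def Sx (n w : ℕ) : Set (Fin 8 →₀ ℕ) := {s | ∑ i, s i = n ∧ ∑ i : Fin 8, s i * (i : ℕ) = w}

noncomputable def U (n w : ℕ) : Submodule ℂ A := MvPolynomial.restrictSupport ℂ (Sx n w)

theorem mem_U {n w : ℕ} {f : A} :
    f ∈ U n w ↔ Eu f = (n : ℂ) • f ∧ Wt f = (w : ℂ) • f := by
  rw [U, MvPolynomial.mem_restrictSupport_iff]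
  constructor
  · intro h
    constructor
    · ext s
      rw [Eu, coeff_diagD, MvPolynomial.coeff_smul, smul_eq_mul]
      by_cases hs : f.coeff s = 0
      · simp [hs]
      · have := h (MvPolynomial.mem_support_iff.mpr hs)
        rw [← this.1]; simp
    · ext s
      rw [Wt, coeff_diagD, MvPolynomial.coeff_smul, smul_eq_mul]
      by_cases hs : f.coeff s = 0
      · simp [hs]
      · have := h (MvPolynomial.mem_support_iff.mpr hs)
        rw [← this.2]; simp
  · rintro ⟨h1, h2⟩ s hs
    have hs' : f.coeff s ≠ 0 := MvPolynomial.mem_support_iff.mp hs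
    have e1 := congrArg (MvPolynomial.coeff s) h1
    have e2 := congrArg (MvPolynomial.coeff s) h2
    rw [Eu, coeff_diagD, MvPolynomial.coeff_smul, smul_eq_mul] at e1
    rw [Wt, coeff_diagD, MvPolynomial.coeff_smul, smul_eq_mul] at e2
    have e1 := mul_right_cancel₀ hs' e1
    have e2 := mul_right_cancel₀ hs' e2
    constructor
    · have : ((∑ i, s i : ℕ) : ℂ) = n := by rw [← e1]; simp
      exact_mod_cast this
    · have : ((∑ i : Fin 8, s i * (i : ℕ) : ℕ) : ℂ) = w := by rw [← e2]; simp
      exact_mod_cast this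

theorem hom_iff {n : ℕ} {f : A} : f.IsHomogeneous n ↔ Eu f = (n : ℂ) • f := by
  constructor
  · intro h
    ext s
    rw [Eu, coeff_diagD, MvPolynomial.coeff_smul, smul_eq_mul]
    by_cases hs : f.coeff s = 0
    · simp [hs]
    · have := h hs
      rw [← this, Finsupp.weight_apply, Finsupp.sum_fintype _ _ (by simp)]; simp
  · intro h s hs
    have e1 := congrArg (MvPolynomial.coeff s) h
    rw [Eu, coeff_diagD, MvPolynomial.coeff_smul, smul_eq_mul] at e1
    have e1 := mul_right_cancel₀ hs e1
    rw [Finsupp.weight_apply, Finsupp.sum_fintype _ _ (by simp)]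
    have : ((∑ i, s i : ℕ) : ℂ) = n := by rw [← e1]; simp
    simpa using (by exact_mod_cast this : ∑ i, s i = n)

theorem D2_mem {n w : ℕ} {f : A} (h : f ∈ U n w) : D2 f ∈ U n (w+1) := by
  rw [mem_U] at h ⊢
  rw [comm_Eu_D2, comm_Wt_D2, h.1, h.2]
  simp [add_smul]

theorem D1_mem {n w : ℕ} {f : A} (h : f ∈ U n (w+1)) : D1 f ∈ U n w := by
  rw [mem_U] at h ⊢
  rw [comm_Eu_D1, comm_Wt_D1, h.1, h.2]
  simp [add_smul]

theorem D1_zero {n : ℕ} {f : A} (h : f ∈ U n 0) : D1 f = 0 := by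
  rw [mem_U] at h
  have h2 := comm_Wt_D1 f
  rw [h.2] at h2
  ext s
  have e := congrArg (MvPolynomial.coeff s) h2
  rw [Wt, coeff_diagD] at e
  simp at e
  have : ((∑ i : Fin 8, s i * (i : ℕ) : ℕ) : ℂ) + 1 ≠ 0 := Nat.cast_add_one_ne_zero _
  have e2 : (((∑ i : Fin 8, s i * (i : ℕ) : ℕ) : ℂ) + 1) * MvPolynomial.coeff s (D1 f) = 0 := by
    push_cast; linear_combination e
  simpa using (mul_eq_zero.mp e2).resolve_left this

theorem U_big {n w : ℕ} (hw : 7 * n < w) {f : A} (h : f ∈ U n w) : f = 0 := by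
  by_contra hf
  obtain ⟨s, hs⟩ := MvPolynomial.support_nonempty.mpr hf
  obtain ⟨h1, h2⟩ := ((MvPolynomial.mem_restrictSupport_iff ℂ).mp h) hs
  have : ∑ i : Fin 8, s i * (i : ℕ) ≤ ∑ i : Fin 8, s i * 7 :=
    Finset.sum_le_sum fun i _ => Nat.mul_le_mul_left _ (by omega)
  rw [← Finset.sum_mul] at this
  omega

theorem H_apply {n w : ℕ} {f : A} (h : f ∈ U n w) :
    D1 (D2 f) = D2 (D1 f) + ((7:ℂ) * n - 2 * w) • f := by
  rw [comm_D1_D2, (mem_U.mp h).1, (mem_U.mp h).2, sub_smul, smul_smul, smul_smul]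

/-- if `v` has weight just above the middle and `D1 D2 v = 0` then `v = 0` -/
theorem inj_aux {n w : ℕ} (hn : 7 * n = 2 * (w + 1)) {v : A} (hv : v ∈ U n w)
    (h0 : D1 (D2 v) = 0) : v = 0 := by
  have hnC : (7:ℂ) * n = 2 * (w + 1) := by exact_mod_cast hn
  by_contra hne
  have key : ∀ k : ℕ, k ≤ w → ∃ u : A, u ∈ U n (w - k) ∧ u ≠ 0 ∧
      D2 (D1 u) = (-((k:ℂ)+1)*(k+2)) • u := by
    intro k
    induction k with
    | zero =>
      intro _
      refine ⟨v, by simpa using hv, hne, ?_⟩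
      have := H_apply hv
      rw [h0] at this
      have h2 : D2 (D1 v) = - (((7:ℂ) * n - 2 * w) • v) := by
        linear_combination -this
      rw [h2, hnC, ← neg_smul]; congr 1; push_cast; ring
    | succ k ih =>
      intro hk
      obtain ⟨u, hu, hune, hue⟩ := ih (by omega)
      have hw : w - k = (w - (k+1)) + 1 := by omega
      rw [hw] at hu
      have hm := D1_mem hu
      refine ⟨D1 u, hm, ?_, ?_⟩
      · intro h
        rw [h, map_zero] at hue
        have h3 : (-((k:ℂ)+1)*(k+2)) ≠ 0 := by
          apply mul_ne_zero
          · rw [neg_ne_zero]; exact_mod_cast Nat.succ_ne_zero k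
          · exact_mod_cast Nat.succ_ne_zero (k+1)
        rcases smul_eq_zero.mp hue.symm with h4 | h4
        · exact h3 h4
        · exact hune h4
      · have h5 := H_apply hm
        rw [hue, D1.map_smul] at h5
        have h2 : D2 (D1 (D1 u)) = (-((k:ℂ)+1)*(k+2) - ((7:ℂ) * n - 2 * (w - (k+1) : ℕ))) • D1 u := by
          rw [sub_smul]; linear_combination -h5
        rw [h2]; congr 1
        rw [hnC, Nat.cast_sub hk]; push_cast; ring
  obtain ⟨u, hu, hune, hue⟩ := key w le_rfl
  rw [Nat.sub_self] at hu
  rw [D1_zero hu, map_zero] at hue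
  have h3 : (-((w:ℂ)+1)*(w+2)) ≠ 0 := by
    apply mul_ne_zero
    · rw [neg_ne_zero]; exact_mod_cast Nat.succ_ne_zero w
    · exact_mod_cast Nat.succ_ne_zero (w+1)
  rcases smul_eq_zero.mp hue.symm with h4 | h4
  · exact h3 h4
  · exact hune h4

/-- weight zero and killed by `D1` implies killed by `D2` -/
theorem D2_of_D1 {n w : ℕ} (hn : 7 * n = 2 * w) {f : A} (hf : f ∈ U n w)
    (h0 : D1 f = 0) : D2 f = 0 := by
  have hnC : (7:ℂ) * n = 2 * w := by exact_mod_cast hn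
  by_contra hne
  have key : ∀ k : ℕ, ∃ u : A, u ∈ U n (w + 1 + k) ∧ u ≠ 0 ∧
      D2 (D1 u) = (-((k:ℂ))*(k+1)) • u := by
    intro k
    induction k with
    | zero =>
      refine ⟨D2 f, D2_mem hf, hne, ?_⟩
      have h1 := H_apply hf
      rw [h0, map_zero, hnC] at h1
      simp at h1
      rw [h1]; simp
    | succ k ih =>
      obtain ⟨u, hu, hune, hue⟩ := ih
      have hm := D2_mem hu
      have h1 : D1 (D2 u) = (-((k:ℂ)+1)*(k+2)) • u := by
        rw [H_apply hu, hue, hnC, ← add_smul]; congr 1; push_cast; ring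
      refine ⟨D2 u, hm, ?_, ?_⟩
      · intro h
        rw [h, map_zero] at h1
        have h3 : (-((k:ℂ)+1)*(k+2)) ≠ 0 := by
          apply mul_ne_zero
          · rw [neg_ne_zero]; exact_mod_cast Nat.succ_ne_zero k
          · exact_mod_cast Nat.succ_ne_zero (k+1)
        rcases smul_eq_zero.mp h1.symm with h4 | h4
        · exact h3 h4
        · exact hune h4
      · rw [h1, D2.map_smul]; congr 1; push_cast; ring
  obtain ⟨u, hu, hune, -⟩ := key (7 * n)
  exact hune (U_big (by omega) hu)

theorem mem_V {n : ℕ} {f : A} : f ∈ V n ↔ f.IsHomogeneous n ∧ D1 f = 0 ∧ D2 f = 0 := by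
  simp [V, and_assoc]

theorem V_sub_U {n w : ℕ} (hn : 7 * n = 2 * w) {f : A} (hf : f ∈ V n) : f ∈ U n w := by
  obtain ⟨h1, h2, h3⟩ := mem_V.mp hf
  have hnC : (7:ℂ) * n = 2 * w := by exact_mod_cast hn
  have h4 := comm_D1_D2 f
  have h1 := hom_iff.mp h1
  rw [h2, h3, map_zero, map_zero, h1, zero_add, smul_smul, hnC, ← smul_smul, ← smul_sub] at h4
  have h5 := (smul_eq_zero.mp h4.symm).resolve_left two_ne_zero
  exact mem_U.mpr ⟨h1, (sub_eq_zero.mp h5).symm⟩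

theorem U_hom {n w : ℕ} {f : A} (hf : f ∈ U n w) : f.IsHomogeneous n := hom_iff.mpr (mem_U.mp hf).1

theorem finite_Sx (n w : ℕ) : (Sx n w).Finite := by
  apply Set.Finite.subset (Set.finite_Iic (Finsupp.equivFunOnFinite.symm (fun _ : Fin 8 => n)))
  intro s hs i
  rw [← hs.1]
  exact Finset.single_le_sum (f := fun i => s i) (fun _ _ => Nat.zero_le _) (Finset.mem_univ i)

instance finU (n w : ℕ) : FiniteDimensional ℂ (U n w) := by
  have := (finite_Sx n w).to_subtype
  exact Module.Finite.of_basis (MvPolynomial.basisRestrictSupport ℂ (Sx n w))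

theorem finrank_U (n w : ℕ) : Module.finrank ℂ (U n w) = Nat.card (Sx n w) := by
  exact Module.finrank_eq_nat_card_basis (MvPolynomial.basisRestrictSupport ℂ (Sx n w))

theorem finV {n w : ℕ} (hn : 7 * n = 2 * w) : FiniteDimensional ℂ (V n) :=
  Submodule.finiteDimensional_of_le (S₂ := U n w) fun _ hf => V_sub_U hn hf

theorem V_upper {n w : ℕ} (hn : 7 * n = 2 * (w+1)) :
    Module.finrank ℂ (V n) + Nat.card (Sx n w) ≤ Nat.card (Sx n (w+1)) := by
  have := finV hn
  rw [← finrank_U, ← finrank_U]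
  set g : U n w →ₗ[ℂ] A := D2.toLinearMap.domRestrict (U n w) with hg
  have hinj : Function.Injective g := by
    rw [← LinearMap.ker_eq_bot, LinearMap.ker_eq_bot']
    rintro ⟨v, hv⟩ h
    have h' : D2 v = 0 := h
    exact Subtype.ext (inj_aux hn hv (by rw [h', map_zero]))
  have hM : LinearMap.range g ≤ U n (w+1) := by
    rintro _ ⟨⟨f, hf⟩, rfl⟩
    exact D2_mem hf
  have hr := LinearMap.finrank_range_of_inj hinj
  have hdis : V n ⊓ LinearMap.range g = ⊥ := by
    rw [eq_bot_iff]
    rintro _ ⟨h1, ⟨⟨f, hf⟩, rfl⟩⟩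
    have h2 : D1 (D2 f) = 0 := (mem_V.mp h1).2.1
    have h3 := inj_aux hn hf h2
    subst h3
    exact map_zero D2
  have := Submodule.finrank_sup_add_finrank_inf_eq (V n) (LinearMap.range g)
  rw [hdis, finrank_bot, add_zero, hr] at this
  rw [← this]
  exact Submodule.finrank_mono (sup_le (fun _ h => V_sub_U hn h) hM)

theorem V_lower {n w : ℕ} (hn : 7 * n = 2 * (w+1)) :
    Nat.card (Sx n (w+1)) ≤ Module.finrank ℂ (V n) + Nat.card (Sx n w) := by
  have := finV hn
  rw [← finrank_U, ← finrank_U]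
  set g : U n (w+1) →ₗ[ℂ] A := D1.toLinearMap.domRestrict (U n (w+1)) with hg
  have hM : LinearMap.range g ≤ U n w := by
    rintro _ ⟨⟨f, hf⟩, rfl⟩
    exact D1_mem hf
  have h1 := LinearMap.finrank_range_add_finrank_ker g
  have h2 := Submodule.finrank_mono hM
  have h3 : Module.finrank ℂ (LinearMap.ker g) ≤ Module.finrank ℂ (V n) := by
    rw [(Submodule.equivMapOfInjective (U n (w+1)).subtype
      (Submodule.injective_subtype _) (LinearMap.ker g)).finrank_eq]
    apply Submodule.finrank_mono
    rintro _ ⟨⟨f, hf⟩, h, rfl⟩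
    have h' : D1 f = 0 := h
    exact mem_V.mpr ⟨U_hom hf, h', D2_of_D1 hn hf h'⟩
  omega

end Septic

namespace Septic

def force {α : Type} (n : ℕ) (f : ℕ → α) : α := Nat.rec (f 0) (fun k _ => f (Nat.succ k)) n

theorem force_eq {α : Type} (n : ℕ) (f : ℕ → α) : force n f = f n := by
  cases n <;> rfl

def forceL {α : Type} : List ℕ → (List ℕ → α) → α
  | [], f => f []
  | x :: xs, f => force x fun z => forceL xs fun l => f (z :: l)

theorem forceL_eq {α : Type} (l : List ℕ) (f : List ℕ → α) : forceL l f = f l := by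
  induction l generalizing f with
  | nil => rfl
  | cons x xs ih => rw [forceL, force_eq, ih]

def addR : List ℕ → List ℕ → List ℕ
  | [], ys => ys
  | x :: xs, [] => x :: xs
  | x :: xs, y :: ys => (x + y) :: addR xs ys

theorem getD_addR (l m : List ℕ) (w : ℕ) : (addR l m).getD w 0 = l.getD w 0 + m.getD w 0 := by
  induction l generalizing m w with
  | nil => simp [addR]
  | cons x xs ih =>
    cases m with
    | nil => simp [addR]
    | cons y ys => cases w <;> simp only [addR, ih, List.getD_cons_zero, List.getD_cons_succ]

def shR : ℕ → List ℕ → List ℕ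
  | 0, l => l
  | k + 1, l => 0 :: shR k l

theorem getD_shR (k : ℕ) (l : List ℕ) (w : ℕ) :
    (shR k l).getD w 0 = if k ≤ w then l.getD (w - k) 0 else 0 := by
  induction k generalizing w with
  | zero => simp [shR]
  | succ k ih => cases w <;> simp [shR, ih, List.getD_cons_zero, List.getD_cons_succ, -List.getD_eq_getElem?_getD]

/-- number of exponents in variables of weights `0, …, k-1` -/
def cnt : ℕ → ℕ → ℕ → ℕ
  | 0, 0, 0 => 1
  | 0, _, _ => 0
  | k + 1, 0, w => cnt k 0 w
  | k + 1, n + 1, w => cnt k (n + 1) w + if k ≤ w then cnt (k + 1) n (w - k) else 0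

def scanR (k : ℕ) : List ℕ → List (List ℕ) → List (List ℕ)
  | _, [] => []
  | p, r :: rs => forceL (addR r (shR k p)) fun x => x :: scanR k x rs

def RowOK (k n : ℕ) (r : List ℕ) : Prop := ∀ w, r.getD w 0 = cnt k n w

def TabOK (k n : ℕ) : List (List ℕ) → Prop
  | [] => True
  | r :: rs => RowOK k n r ∧ TabOK k (n + 1) rs

theorem scanR_ok (k n : ℕ) (p : List ℕ) (rs : List (List ℕ)) (hp : RowOK (k + 1) n p)
    (h : TabOK k (n + 1) rs) : TabOK (k + 1) (n + 1) (scanR k p rs) := by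
  induction rs generalizing n p with
  | nil => trivial
  | cons r rs ih =>
    rw [scanR, forceL_eq]
    have h1 : RowOK (k + 1) (n + 1) (addR r (shR k p)) := by
      intro w
      rw [getD_addR, getD_shR, h.1 w, hp, cnt]
    exact ⟨h1, ih _ _ h1 h.2⟩

def tab (N : ℕ) : ℕ → List (List ℕ)
  | 0 => [1] :: List.replicate N []
  | k + 1 => match tab N k with
    | [] => []
    | r :: rs => r :: scanR k r rs

theorem tab_ok (N k : ℕ) : TabOK k 0 (tab N k) := by
  induction k with
  | zero =>
    refine ⟨?_, ?_⟩
    · intro w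
      cases w <;> simp [cnt]
    · have : ∀ M n, TabOK 0 (n + 1) (List.replicate M []) := by
        intro M
        induction M with
        | zero => intro n; trivial
        | succ M ih =>
          intro n
          refine ⟨?_, ih _⟩
          intro w
          simp [cnt]
      exact this N 0
  | succ k ih =>
    rw [tab]
    revert ih
    cases tab N k with
    | nil => intro _; trivial
    | cons r rs =>
      intro ih
      have h1 : RowOK (k + 1) 0 r := by
        intro w
        rw [ih.1 w, cnt]
      exact ⟨h1, scanR_ok k 0 r rs h1 ih.2⟩

theorem TabOK.get {k n : ℕ} {t : List (List ℕ)} (h : TabOK k n t) (i : ℕ) (hi : i < t.length) (w : ℕ) :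
    (t.getD i []).getD w 0 = cnt k (n + i) w := by
  induction t generalizing n i with
  | nil => simp at hi
  | cons r rs ih =>
    cases i with
    | zero => exact h.1 w
    | succ i =>
      have := ih h.2 i (by simpa using hi)
      rw [List.getD_cons_succ, this]; congr 1; omega

def chk (t : List (List ℕ)) (l : List (ℕ × ℕ × ℕ)) : Bool :=
  l.all fun x => decide (x.1 < t.length) && ((t.getD x.1 []).getD x.2.1 0).beq x.2.2

def vals : List (ℕ × ℕ × ℕ) := [(6,21,94),(6,20,94),(10,35,734),(10,34,734),(16,56,6375),(16,55,6357),
  (20,70,19138),(20,69,19103),(22,77,30982),(22,76,30956),(26,91,73316),(26,90,73264)]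

theorem chk_tab : chk (tab 26 8) vals = true := by decide +kernel

theorem cnt_val : ∀ x ∈ vals, cnt 8 x.1 x.2.1 = x.2.2 := by
  intro x hx
  have h := List.all_eq_true.mp chk_tab x hx
  rw [Bool.and_eq_true, decide_eq_true_eq] at h
  have h2 := Nat.eq_of_beq_eq_true h.2
  rw [(tab_ok 26 8).get _ h.1] at h2
  simpa using h2

def Tx (k n w : ℕ) : Set (Fin k → ℕ) := {s | ∑ i, s i = n ∧ ∑ i : Fin k, s i * (i : ℕ) = w}

instance finTx (k n w : ℕ) : Finite (Tx k n w) := by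
  apply Set.Finite.to_subtype
  apply Set.Finite.subset (Set.finite_Iic (fun _ : Fin k => n))
  intro s hs i
  rw [← hs.1]
  exact Finset.single_le_sum (f := fun i => s i) (fun _ _ => Nat.zero_le _) (Finset.mem_univ i)

theorem snoc_mem {k n w : ℕ} (s : Fin k → ℕ) (j : ℕ) :
    (Fin.snoc s j : Fin (k+1) → ℕ) ∈ Tx (k+1) n w ↔ ∑ i, s i + j = n ∧ ∑ i : Fin k, s i * (i : ℕ) + j * k = w := by
  simp [Tx, Fin.sum_univ_castSucc]

theorem Tx_zero (k w : ℕ) : (Tx (k+1) 0 w) = (fun s => (Fin.snoc s 0 : Fin (k+1) → ℕ)) '' Tx k 0 w := by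
  ext s
  obtain ⟨s, j, rfl⟩ : ∃ s' j, s = (Fin.snoc s' j : Fin (k+1) → ℕ) := ⟨Fin.init s, s (Fin.last k), by simp⟩
  rw [snoc_mem]
  constructor
  · rintro ⟨h1, h2⟩
    have : j = 0 := by omega
    subst this
    exact ⟨s, ⟨by simpa using h1, by simpa using h2⟩, rfl⟩
  · rintro ⟨s', ⟨h1, h2⟩, h3⟩
    have h3 := Fin.snoc_inj.mp h3
    rw [← h3.1, ← h3.2]
    exact ⟨by simpa using h1, by simpa using h2⟩

theorem snoc_inj0 (k : ℕ) : Function.Injective (fun s => (Fin.snoc s 0 : Fin (k+1) → ℕ)) := fun _ _ h =>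
  (Fin.snoc_inj.mp h).1

def bump (k : ℕ) (s : Fin (k+1) → ℕ) : Fin (k+1) → ℕ := Fin.snoc (Fin.init s) (s (Fin.last k) + 1)

theorem bump_inj (k : ℕ) : Function.Injective (bump k) := by
  intro a b h
  have h := Fin.snoc_inj.mp h
  rw [← Fin.snoc_init_self a, ← Fin.snoc_init_self b, h.1, Nat.succ_injective h.2]

theorem Tx_succ (k n w : ℕ) : (Tx (k+1) (n+1) w) =
    (fun s => (Fin.snoc s 0 : Fin (k+1) → ℕ)) '' Tx k (n+1) w ∪
      (if k ≤ w then bump k '' Tx (k+1) n (w-k) else ∅) := by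
  ext s
  obtain ⟨s, j, rfl⟩ : ∃ s' j, s = (Fin.snoc s' j : Fin (k+1) → ℕ) := ⟨Fin.init s, s (Fin.last k), by simp⟩
  rw [snoc_mem, Set.mem_union]
  constructor
  · rintro ⟨h1, h2⟩
    cases j with
    | zero => left; exact ⟨s, ⟨by simpa using h1, by simpa using h2⟩, rfl⟩
    | succ j =>
      right
      rw [add_mul] at h2
      rw [if_pos (by omega)]
      refine ⟨Fin.snoc s j, ?_, by simp [bump]⟩
      rw [snoc_mem]; omega
  · rintro (⟨s', ⟨h1, h2⟩, h3⟩ | h)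
    · have h3 := Fin.snoc_inj.mp h3
      rw [← h3.1, ← h3.2]
      exact ⟨by simpa using h1, by simpa using h2⟩
    · split_ifs at h with hk
      · obtain ⟨s', h1, h3⟩ := h
        obtain ⟨h3, h4⟩ := Fin.snoc_inj.mp h3
        rw [← Fin.snoc_init_self s', snoc_mem, h3] at h1
        rw [← h4, add_mul]
        omega
      · exact h.elim

theorem card_Tx (k n w : ℕ) : Nat.card (Tx k n w) = cnt k n w := by
  induction k generalizing n w with
  | zero =>
    by_cases h : n = 0 ∧ w = 0
    · obtain ⟨rfl, rfl⟩ := h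
      rw [cnt, show Tx 0 0 0 = Set.univ from by ext; simp [Tx]]
      simp
    · have : Tx 0 n w = ∅ := by
        ext; simp [Tx]; omega
      rw [this]
      rw [not_and_or] at h
      rcases n with _ | n <;> rcases w with _ | w <;> simp [cnt] at h ⊢
  | succ k ih =>
    induction n generalizing w with
    | zero =>
      rw [Tx_zero, Nat.card_image_of_injective (snoc_inj0 k), ih, cnt]
    | succ n ih2 =>
      rw [cnt, ← ih, ← Nat.card_image_of_injective (snoc_inj0 k), Tx_succ]
      rw [Nat.card_coe_set_eq, Nat.card_coe_set_eq, Set.ncard_union_eq ?_ ?_ ?_]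
      · congr 1
        split_ifs with h
        · rw [← ih2, ← Nat.card_image_of_injective (bump_inj k), Nat.card_coe_set_eq]
        · simp
      · rw [Set.disjoint_left]
        rintro _ ⟨s, h1, rfl⟩ h
        split_ifs at h with hk
        · obtain ⟨s', h1, h3⟩ := h
          have := (Fin.snoc_inj.mp h3).2
          omega
        · exact h
      · exact (Set.toFinite (Tx k (n+1) w)).image _
      · split_ifs
        · exact (Set.toFinite (Tx (k+1) n (w-k))).image _
        · exact Set.finite_empty

theorem card_Sx (n w : ℕ) : Nat.card (Sx n w) = cnt 8 n w := by
  rw [← card_Tx]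
  exact Nat.card_congr (Equiv.subtypeEquiv Finsupp.equivFunOnFinite (fun s => Iff.rfl))

theorem card_val {n w c : ℕ} (h : (n, w, c) ∈ vals) : Nat.card (Sx n w) = c := by
  rw [card_Sx]; exact cnt_val _ h

theorem dim6 : Module.finrank ℂ (V 6) = 0 := by
  have h : _ + Nat.card (Sx 6 20) ≤ _ := V_upper rfl
  rw [card_val (c := 94) (by simp [vals]), card_val (c := 94) (by simp [vals])] at h
  omega
theorem dim10 : Module.finrank ℂ (V 10) = 0 := by
  have h : _ + Nat.card (Sx 10 34) ≤ _ := V_upper rfl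
  rw [card_val (c := 734) (by simp [vals]), card_val (c := 734) (by simp [vals])] at h
  omega
theorem dim16 : 18 ≤ Module.finrank ℂ (V 16) := by
  have h := V_lower (n := 16) (w := 55) rfl
  rw [card_val (c := 6375) (by simp [vals]), card_val (c := 6357) (by simp [vals])] at h
  omega
theorem dim20 : Module.finrank ℂ (V 20) ≤ 35 := by
  have h : _ + Nat.card (Sx 20 69) ≤ _ := V_upper rfl
  rw [card_val (c := 19103) (by simp [vals]), card_val (c := 19138) (by simp [vals])] at h
  exact (Nat.le_sub_of_add_le h).trans (by norm_num)
theorem dim22 : 26 ≤ Module.finrank ℂ (V 22) := by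
  have h := V_lower (n := 22) (w := 76) rfl
  rw [card_val (c := 30982) (by simp [vals]), card_val (c := 30956) (by simp [vals])] at h
  omega
theorem dim26 : Module.finrank ℂ (V 26) ≤ 52 := by
  have h : _ + Nat.card (Sx 26 90) ≤ _ := V_upper rfl
  rw [card_val (c := 73264) (by simp [vals]), card_val (c := 73316) (by simp [vals])] at h
  exact (Nat.le_sub_of_add_le h).trans (by norm_num)

end Septic

namespace Septic

section trans
variable {B : Type} [CommRing B]

/-- partial derivative in the first variable of a form of order `m` -/
noncomputable def dx (m : ℤ) (F : Polynomial B) : Polynomial B :=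
  (m : Polynomial B) * F - Polynomial.X * Polynomial.derivative F

theorem dx_add (m : ℤ) (F G : Polynomial B) : dx m (F + G) = dx m F + dx m G := by
  simp only [dx, Polynomial.derivative_add]; ring

theorem dx_sub (m : ℤ) (F G : Polynomial B) : dx m (F - G) = dx m F - dx m G := by
  simp only [dx, Polynomial.derivative_sub]; ring

theorem dx_smul (m a : ℤ) (F : Polynomial B) : dx m (a • F) = a • dx m F := by
  simp only [dx, zsmul_eq_mul, Polynomial.derivative_mul, Polynomial.derivative_intCast]; ring

theorem der_dx (m : ℤ) (F : Polynomial B) :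
    Polynomial.derivative (dx m F) = dx (m - 1) (Polynomial.derivative F) := by
  simp only [dx, Polynomial.derivative_sub, Polynomial.derivative_mul,
    Polynomial.derivative_intCast, Polynomial.derivative_X]
  push_cast; ring

theorem coeff_dx (m : ℤ) (F : Polynomial B) (i : ℕ) :
    (dx m F).coeff i = ((m : B) - i) * F.coeff i := by
  rw [dx, Polynomial.coeff_sub, Polynomial.coeff_intCast_mul]
  cases i with
  | zero => simp
  | succ i => rw [Polynomial.coeff_X_mul, Polynomial.coeff_derivative]; push_cast; ring

noncomputable def Tr : ℕ → ℤ → ℤ → Polynomial B → Polynomial B → Polynomial B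
  | 0, _, _, F, G => F * G
  | k + 1, m, n, F, G => Tr k (m - 1) (n - 1) (dx m F) (Polynomial.derivative G)
      - Tr k (m - 1) (n - 1) (Polynomial.derivative F) (dx n G)

theorem Tr_add_left (k : ℕ) (m n : ℤ) (F F' G : Polynomial B) :
    Tr k m n (F + F') G = Tr k m n F G + Tr k m n F' G := by
  induction k generalizing m n F F' G with
  | zero => simp only [Tr]; ring
  | succ k ih => simp only [Tr, dx_add, Polynomial.derivative_add, ih]; ring

theorem Tr_add_right (k : ℕ) (m n : ℤ) (F G G' : Polynomial B) :
    Tr k m n F (G + G') = Tr k m n F G + Tr k m n F G' := by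
  induction k generalizing m n F G G' with
  | zero => simp only [Tr]; ring
  | succ k ih => simp only [Tr, dx_add, Polynomial.derivative_add, ih]; ring

theorem Tr_smul_left (k : ℕ) (m n a : ℤ) (F G : Polynomial B) :
    Tr k m n (a • F) G = a • Tr k m n F G := by
  induction k generalizing m n F G with
  | zero => simp only [Tr, smul_mul_assoc]
  | succ k ih => simp only [Tr, dx_smul, Polynomial.derivative_smul, ih, smul_sub]

theorem Tr_smul_right (k : ℕ) (m n a : ℤ) (F G : Polynomial B) :
    Tr k m n F (a • G) = a • Tr k m n F G := by
  induction k generalizing m n F G with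
  | zero => simp only [Tr, mul_smul_comm]
  | succ k ih => simp only [Tr, dx_smul, Polynomial.derivative_smul, ih, smul_sub]

theorem Tr_zero_left (k : ℕ) (m n : ℤ) (G : Polynomial B) : Tr k m n 0 G = 0 := by
  have := Tr_smul_left k m n 0 0 G
  simpa using this

theorem Tr_zero_right (k : ℕ) (m n : ℤ) (F : Polynomial B) : Tr k m n F 0 = 0 := by
  have := Tr_smul_right k m n 0 F 0
  simpa using this

theorem Tr_E (E : ℤ → Polynomial B → Polynomial B) (a b : ℤ)
    (hs : ∀ m F G, E m (F - G) = E m F - E m G)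
    (h1 : ∀ m n F G, E (m + n) (F * G) = E m F * G + F * E n G)
    (h2 : ∀ m F, E (m - 1) (dx m F) = dx m (E m F) + a • Polynomial.derivative F)
    (h3 : ∀ m F, E (m - 1) (Polynomial.derivative F) = Polynomial.derivative (E m F) + b • dx m F)
    (k : ℕ) (m n : ℤ) (F G : Polynomial B) :
    E (m + n - 2 * k) (Tr k m n F G) = Tr k m n (E m F) G + Tr k m n F (E n G) := by
  induction k generalizing m n F G with
  | zero => simpa [Tr] using h1 m n F G
  | succ k ih =>
    have e : m + n - 2 * ((k + 1 : ℕ) : ℤ) = (m - 1) + (n - 1) - 2 * k := by push_cast; ring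
    simp only [e, Tr, hs, ih, h2, h3, Tr_add_left, Tr_add_right, Tr_smul_left, Tr_smul_right]
    ring

theorem dx_map {B' : Type} [CommRing B'] (φ : B →+* B') (m : ℤ) (F : Polynomial B) :
    (dx m F).map φ = dx m (F.map φ) := by
  simp [dx, Polynomial.derivative_map]

theorem Tr_map {B' : Type} [CommRing B'] (φ : B →+* B') (k : ℕ) (m n : ℤ) (F G : Polynomial B) :
    (Tr k m n F G).map φ = Tr k m n (F.map φ) (G.map φ) := by
  induction k generalizing m n F G with
  | zero => simp [Tr]
  | succ k ih => simp [Tr, ih, dx_map, Polynomial.derivative_map]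

/-- the base form -/
noncomputable def base (x : Fin 8 → B) : Polynomial B :=
  ∑ i : Fin 8, Polynomial.monomial (i : ℕ) ((Nat.choose 7 i : B) * x i)

theorem base_map {B' : Type} [CommRing B'] (φ : B →+* B') (x : Fin 8 → B) :
    (base x).map φ = base (fun i => φ (x i)) := by
  simp [base, Polynomial.map_sum]

def sh (s : List (ℕ × ℤ)) : List (ℕ × ℕ × ℕ) → List (ℕ × ℤ)
  | [] => s
  | (i, j, k) :: l =>
    sh (s ++ [((s.getD i (0,0)).1 + (s.getD j (0,0)).1,
      (s.getD i (0,0)).2 + (s.getD j (0,0)).2 - 2 * k)]) l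

noncomputable def run (s : List (ℤ × Polynomial B)) : List (ℕ × ℕ × ℕ) → List (ℤ × Polynomial B)
  | [] => s
  | (i, j, k) :: l =>
    run (s ++ [((s.getD i (0,0)).1 + (s.getD j (0,0)).1 - 2 * k,
      Tr k (s.getD i (0,0)).1 (s.getD j (0,0)).1 (s.getD i (0,0)).2 (s.getD j (0,0)).2)]) l

theorem getD_map' {α β : Type} (f : α → β) (l : List α) (i : ℕ) (d : α) :
    (l.map f).getD i (f d) = f (l.getD i d) := by
  simp [List.getD_eq_getElem?_getD]

theorem run_map {B' : Type} [CommRing B'] (φ : B →+* B') (s : List (ℤ × Polynomial B))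
    (l : List (ℕ × ℕ × ℕ)) :
    (run s l).map (fun p => (p.1, p.2.map φ)) = run (s.map (fun p => (p.1, p.2.map φ))) l := by
  induction l generalizing s with
  | nil => rfl
  | cons a l ih =>
    obtain ⟨i, j, k⟩ := a
    rw [run, ih, run]
    have h : ∀ i, (s.map (fun p => (p.1, p.2.map φ))).getD i (0,0) =
        ((s.getD i (0,0)).1, (s.getD i (0,0)).2.map φ) := by
      intro i
      rw [← getD_map' (fun p : ℤ × Polynomial B => (p.1, p.2.map φ)) s i (0,0)]
      simp
    simp only [h, List.map_append, List.map_cons, List.map_nil, Tr_map]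

end trans

/-- coefficientwise action of a derivation -/
noncomputable def mD (D : Derivation ℂ A A) (F : Polynomial A) : Polynomial A :=
  F.sum fun n a => Polynomial.monomial n (D a)

theorem coeff_mD (D : Derivation ℂ A A) (F : Polynomial A) (i : ℕ) :
    (mD D F).coeff i = D (F.coeff i) := by
  rw [mD, Polynomial.sum, Polynomial.finsetSum_coeff]
  simp only [Polynomial.coeff_monomial]
  rw [Finset.sum_ite_eq']
  split_ifs with h
  · rfl
  · rw [Polynomial.notMem_support_iff.mp h, map_zero]

theorem mD_sub (D : Derivation ℂ A A) (F G : Polynomial A) : mD D (F - G) = mD D F - mD D G := by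
  ext1 i; simp [coeff_mD]

theorem mD_mul (D : Derivation ℂ A A) (F G : Polynomial A) :
    mD D (F * G) = mD D F * G + F * mD D G := by
  ext1 i
  rw [coeff_mD, Polynomial.coeff_add, Polynomial.coeff_mul, Polynomial.coeff_mul,
    Polynomial.coeff_mul, map_sum, ← Finset.sum_add_distrib]
  refine Finset.sum_congr rfl fun x _ => ?_
  rw [coeff_mD, coeff_mD, D.leibniz, smul_eq_mul, smul_eq_mul]; ring

theorem mD_der (D : Derivation ℂ A A) (F : Polynomial A) :
    mD D (Polynomial.derivative F) = Polynomial.derivative (mD D F) := by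
  ext1 i
  rw [coeff_mD, Polynomial.coeff_derivative, Polynomial.coeff_derivative, coeff_mD, D.leibniz]
  have : D ((i : A) + 1) = 0 := by
    rw [map_add, D.map_natCast, Derivation.map_one_eq_zero, add_zero]
  rw [this, smul_zero, zero_add, smul_eq_mul, mul_comm]

theorem mD_dx (D : Derivation ℂ A A) (m : ℤ) (F : Polynomial A) :
    mD D (dx m F) = dx m (mD D F) := by
  ext1 i
  rw [coeff_mD, coeff_dx, coeff_dx, coeff_mD, D.leibniz]
  have : D ((m : A) - i) = 0 := by
    rw [map_sub, D.map_natCast, D.map_intCast, sub_zero]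
  rw [this, smul_zero, add_zero, smul_eq_mul]

noncomputable def E1 (m : ℤ) (F : Polynomial A) : Polynomial A := mD D1 F - Polynomial.X * dx m F
noncomputable def E2 (_ : ℤ) (F : Polynomial A) : Polynomial A := mD D2 F - Polynomial.derivative F

theorem Tr_E1 (k : ℕ) (m n : ℤ) (F G : Polynomial A) :
    E1 (m + n - 2 * k) (Tr k m n F G) = Tr k m n (E1 m F) G + Tr k m n F (E1 n G) := by
  apply Tr_E E1 0 1
  · intro m F G; simp only [E1, mD_sub, dx_sub]; ring
  · intro m n F G
    simp only [E1, mD_mul, dx, Polynomial.derivative_mul]; push_cast; ring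
  · intro m F
    simp only [E1, mD_dx, dx_sub]
    have : dx m (Polynomial.X * dx m F) = Polynomial.X * dx (m-1) (dx m F) := by
      conv_lhs => rw [dx]
      conv_rhs => rw [dx]
      rw [Polynomial.derivative_mul, Polynomial.derivative_X]; push_cast; ring
    rw [this]; simp
  · intro m F
    simp only [E1, mD_der, Polynomial.derivative_sub, Polynomial.derivative_mul, der_dx,
      Polynomial.derivative_X]
    rw [one_smul]; ring

theorem Tr_E2 (k : ℕ) (m n : ℤ) (F G : Polynomial A) :
    E2 (m + n - 2 * k) (Tr k m n F G) = Tr k m n (E2 m F) G + Tr k m n F (E2 n G) := by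
  apply Tr_E E2 1 0
  · intro m F G; simp only [E2, mD_sub, Polynomial.derivative_sub]; ring
  · intro m n F G
    simp only [E2, mD_mul, Polynomial.derivative_mul]; ring
  · intro m F
    simp only [E2, mD_dx, dx_sub, der_dx]
    simp only [dx, one_smul]; push_cast; ring
  · intro m F
    simp only [E2, mD_der, Polynomial.derivative_sub]; simp

/-- degree bound -/
def Ord (m : ℤ) (F : Polynomial A) : Prop := ∀ i : ℕ, m < i → F.coeff i = 0
def Hom (d : ℕ) (F : Polynomial A) : Prop := ∀ i : ℕ, (F.coeff i).IsHomogeneous d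

theorem hom_natC (n : ℕ) : (n : A).IsHomogeneous 0 := by
  simpa using MvPolynomial.isHomogeneous_C (Fin 8) (n : ℂ)
theorem hom_intC (n : ℤ) : (n : A).IsHomogeneous 0 := by
  simpa using MvPolynomial.isHomogeneous_C (Fin 8) (n : ℂ)

theorem Hom.dx {d : ℕ} {F : Polynomial A} (h : Hom d F) (m : ℤ) : Hom d (dx m F) := by
  intro i
  rw [coeff_dx]
  have := ((hom_intC m).sub (hom_natC i)).mul (h i)
  simpa using this

theorem Hom.der {d : ℕ} {F : Polynomial A} (h : Hom d F) : Hom d (Polynomial.derivative F) := by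
  intro i
  rw [Polynomial.coeff_derivative]
  have := (h (i+1)).mul (hom_natC (i+1))
  simpa using this

theorem Hom.tr {d e : ℕ} (k : ℕ) (m n : ℤ) {F G : Polynomial A} (hF : Hom d F) (hG : Hom e G) :
    Hom (d + e) (Tr k m n F G) := by
  induction k generalizing m n F G with
  | zero =>
    intro i
    rw [Tr, Polynomial.coeff_mul]
    exact MvPolynomial.IsHomogeneous.sum _ _ _ fun x _ => (hF _).mul (hG _)
  | succ k ih =>
    intro i
    rw [Tr, Polynomial.coeff_sub]
    exact (ih _ _ (hF.dx _) hG.der i).sub (ih _ _ hF.der (hG.dx _) i)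

theorem Ord.tr (k : ℕ) {m n : ℤ} {F G : Polynomial A} (hF : Ord m F) (hG : Ord n G) :
    Ord (m + n - 2 * k) (Tr k m n F G) := by
  induction k generalizing m n F G with
  | zero =>
    intro i hi
    rw [Tr, Polynomial.coeff_mul]
    refine Finset.sum_eq_zero fun x hx => ?_
    have := Finset.HasAntidiagonal.mem_antidiagonal.mp hx
    by_cases h : m < x.1
    · rw [hF _ h, zero_mul]
    · rw [hG x.2 (by push_cast at hi; omega), mul_zero]
  | succ k ih =>
    have hd : ∀ {m : ℤ} {F : Polynomial A}, Ord m F → Ord (m - 1) (Polynomial.derivative F) := by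
      intro m F h i hi
      rw [Polynomial.coeff_derivative, h _ (by push_cast; omega), zero_mul]
    have hx : ∀ {m : ℤ} {F : Polynomial A}, Ord m F → Ord (m - 1) (Septic.dx m F) := by
      intro m F h i hi
      rw [coeff_dx]
      rcases eq_or_ne (i : ℤ) m with h1 | h1
      · rw [← h1]; simp
      · rw [h _ (by omega), mul_zero]
    intro i hi
    rw [Tr, Polynomial.coeff_sub, ih (hx hF) (hd hG) i (by push_cast at hi ⊢; omega),
      ih (hd hF) (hx hG) i (by push_cast at hi ⊢; omega), sub_zero]

structure Cov (d : ℕ) (m : ℤ) (F : Polynomial A) : Prop where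
  hom : Hom d F
  ord : Ord m F
  e1 : E1 m F = 0
  e2 : E2 m F = 0

theorem Cov.tr {d e : ℕ} {m n : ℤ} {F G : Polynomial A} (hF : Cov d m F) (hG : Cov e n G) (k : ℕ) :
    Cov (d + e) (m + n - 2 * k) (Tr k m n F G) where
  hom := hF.hom.tr k m n hG.hom
  ord := hF.ord.tr k hG.ord
  e1 := by rw [Tr_E1, hF.e1, hG.e1, Tr_zero_left, Tr_zero_right, add_zero]
  e2 := by rw [Tr_E2, hF.e2, hG.e2, Tr_zero_left, Tr_zero_right, add_zero]

theorem Cov.zero : Cov 0 0 0 where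
  hom := fun i => by simpa using MvPolynomial.isHomogeneous_zero (Fin 8) ℂ 0
  ord := fun i _ => by simp
  e1 := by simp [E1, mD, dx]
  e2 := by simp [E2, mD]

theorem Cov.inv {d : ℕ} {F : Polynomial A} (h : Cov d 0 F) : F.coeff 0 ∈ V d := by
  rw [mem_V]
  refine ⟨h.hom 0, ?_, ?_⟩
  · have := congrArg (fun P => Polynomial.coeff P 0) h.e1
    simpa [E1, coeff_mD] using this
  · have := congrArg (fun P => Polynomial.coeff P 0) h.e2
    simpa [E2, coeff_mD, Polynomial.coeff_derivative, h.ord 1 (by norm_num)] using this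

theorem coeff_base {B : Type} [CommRing B] (x : Fin 8 → B) (i : ℕ) :
    (base x).coeff i = if h : i < 8 then (Nat.choose 7 i : B) * x ⟨i, h⟩ else 0 := by
  rw [base, Polynomial.finsetSum_coeff]
  simp only [Polynomial.coeff_monomial]
  split_ifs with h
  · rw [Finset.sum_eq_single ⟨i, h⟩]
    · simp
    · intro b _ hb
      rw [if_neg]
      intro h'; exact hb (Fin.ext h')
    · simp
  · refine Finset.sum_eq_zero fun j _ => ?_
    rw [if_neg]; omega

theorem der_num2 (D : Derivation ℂ A A) : D (21 : A) = 0 ∧ D (35 : A) = 0 :=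
  ⟨D.map_natCast 21, D.map_natCast 35⟩

theorem Cov.base : Cov 1 7 (base (fun i => (MvPolynomial.X i : A))) where
  hom := by
    intro i
    rw [coeff_base]
    split_ifs
    · have := (hom_natC (Nat.choose 7 i)).mul (MvPolynomial.isHomogeneous_X ℂ (⟨i, by assumption⟩ : Fin 8))
      simpa using this
    · exact MvPolynomial.isHomogeneous_zero (Fin 8) ℂ 1
  ord := by
    intro i hi
    rw [coeff_base, dif_neg (by omega)]
  e1 := by
    ext1 i
    rw [E1, Polynomial.coeff_sub, coeff_mD, coeff_base]
    rcases i with _ | i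
    · simp [D1]
    · rw [Polynomial.coeff_X_mul, coeff_dx, coeff_base]
      by_cases h : i < 8
      · interval_cases i <;> simp [D1, der_num, der_num2, Nat.choose] <;> ring
      · rw [dif_neg h, dif_neg (by omega)]; simp
  e2 := by
    ext1 i
    rw [E2, Polynomial.coeff_sub, coeff_mD, coeff_base, Polynomial.coeff_derivative, coeff_base]
    by_cases h : i < 8
    · interval_cases i <;> simp [D2, der_num, der_num2, Nat.choose] <;> ring
    · rw [dif_neg h, dif_neg (by omega)]; simp

theorem run_cov (l : List (ℕ × ℕ × ℕ)) (s : List (ℕ × ℤ)) (t : List (ℤ × Polynomial A))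
    (h : List.Forall₂ (fun p q => p.2 = q.1 ∧ Cov p.1 p.2 q.2) s t) :
    List.Forall₂ (fun p q => p.2 = q.1 ∧ Cov p.1 p.2 q.2) (sh s l) (run t l) := by
  induction l generalizing s t with
  | nil => exact h
  | cons a l ih =>
    obtain ⟨i, j, k⟩ := a
    rw [sh, run]
    apply ih
    apply List.rel_append h
    have hg : ∀ i, (s.getD i (0,0)).2 = (t.getD i (0,0)).1 ∧
        Cov (s.getD i (0,0)).1 (s.getD i (0,0)).2 (t.getD i (0,0)).2 := by
      clear ih
      induction h with
      | nil => intro i; simpa using Cov.zero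
      | cons h1 h2 ih =>
        intro i
        cases i with
        | zero => simpa using h1
        | succ i => rw [List.getD_cons_succ, List.getD_cons_succ]; exact ih i
    refine List.Forall₂.cons ⟨?_, ?_⟩ List.Forall₂.nil
    · simp only [(hg i).1, (hg j).1]
    · have := (hg i).2.tr (hg j).2 k
      simp only [← (hg i).1, ← (hg j).1]
      exact this

/-- covariant number `i` of the program, evaluated over a ring -/
noncomputable def cv {B : Type} [CommRing B] (l : List (ℕ × ℕ × ℕ)) (x : Fin 8 → B) (i : ℕ) : B :=
  ((run [(7, base x)] l).getD i (0, 0)).2.coeff 0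

theorem cv_map {B B' : Type} [CommRing B] [CommRing B'] (φ : B →+* B') (l : List (ℕ × ℕ × ℕ))
    (x : Fin 8 → B) (i : ℕ) : φ (cv l x i) = cv l (fun j => φ (x j)) i := by
  have h := run_map φ [(7, base x)] l
  rw [List.map_cons, List.map_nil] at h
  simp only [base_map] at h
  have h2 := getD_map' (fun p : ℤ × Polynomial B => (p.1, p.2.map φ)) (run [(7, base x)] l) i (0,0)
  simp only [Polynomial.map_zero] at h2
  rw [h] at h2
  rw [cv, cv, h2, Polynomial.coeff_map]

theorem cv_inv (l : List (ℕ × ℕ × ℕ)) (i d : ℕ) (h : (sh [(1, 7)] l).getD i (0,0) = (d, 0)) :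
    cv l (fun i => (MvPolynomial.X i : A)) i ∈ V d := by
  have hr := run_cov l [(1, 7)] [(7, base (fun i => (MvPolynomial.X i : A)))]
    (List.Forall₂.cons ⟨rfl, Cov.base⟩ List.Forall₂.nil)
  have hg : ∀ (s : List (ℕ × ℤ)) (t : List (ℤ × Polynomial A)), List.Forall₂ (fun p q => p.2 = q.1 ∧ Cov p.1 p.2 q.2) s t → ∀ i,
        Cov (s.getD i (0,0)).1 (s.getD i (0,0)).2 (t.getD i (0,0)).2 := by
    intro s t h
    induction h with
    | nil => intro i; simpa using Cov.zero
    | cons h1 h2 ih =>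
      intro i
      cases i with
      | zero => simpa using h1.2
      | succ i => rw [List.getD_cons_succ, List.getD_cons_succ]; exact ih i
  have := hg _ _ hr i
  rw [h] at this
  exact this.inv

end Septic

namespace Septic

section binom
variable {K : Type} [CommRing K]

noncomputable def DX : ℕ → ℤ → Polynomial K → Polynomial K
  | 0, _, F => F
  | j + 1, m, F => DX j (m - 1) (dx m F)

theorem iter_dx (i : ℕ) (m : ℤ) (F : Polynomial K) :
    Polynomial.derivative^[i] (dx m F) = dx (m - i) (Polynomial.derivative^[i] F) := by
  induction i generalizing m F with
  | zero => simp
  | succ i ih =>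
    rw [Function.iterate_succ_apply, der_dx, ih, Function.iterate_succ_apply]
    congr 1; push_cast; ring

noncomputable def tf (m n : ℤ) (F G : Polynomial K) (i j : ℕ) : Polynomial K :=
  (-1) ^ i * DX j (m - i) (Polynomial.derivative^[i] F) * DX i (n - j) (Polynomial.derivative^[j] G)

theorem Tr_binom (k : ℕ) (m n : ℤ) (F G : Polynomial K) :
    Tr k m n F G = ∑ p ∈ Finset.HasAntidiagonal.antidiagonal k, (k.choose p.1 : Polynomial K) * tf m n F G p.1 p.2 := by
  induction k generalizing m n F G with
  | zero => simp [Tr, tf, DX]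
  | succ k ih =>
    rw [Finset.sum_antidiagonal_choose_succ_mul, Tr, ih, ih, sub_eq_add_neg, ← Finset.sum_neg_distrib]
    congr 1
    · refine Finset.sum_congr rfl fun p _ => ?_
      simp only [tf, DX, iter_dx, Function.iterate_succ_apply]
      push_cast
      rw [show m - 1 - (p.1 : ℤ) = m - p.1 - 1 by ring, show n - 1 - (p.2 : ℤ) = n - (p.2 + 1) by ring]
    · refine Finset.sum_congr rfl fun p hp => ?_
      rw [Nat.choose_symm_of_eq_add (Finset.HasAntidiagonal.mem_antidiagonal.mp hp).symm]
      simp only [tf, DX, iter_dx, Function.iterate_succ_apply]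
      push_cast
      rw [show m - 1 - (p.1 : ℤ) = m - (p.1 + 1) by ring, show n - 1 - (p.2 : ℤ) = n - p.2 - 1 by ring]
      ring

end binom

section num

def consT (a : ℕ) (l : List ℕ) : List ℕ := force a fun a => match a, l with
  | 0, [] => []
  | a, l => a :: l

def lin (N c s : ℕ) : List ℕ → List ℕ
  | [] => []
  | a :: l => force (Nat.mod (Nat.add c s) N) fun c' => consT (Nat.mod (Nat.mul c a) N) (lin N c' s l)

def derL (N : ℕ) : List ℕ → List ℕ
  | [] => []
  | _ :: l => lin N 1 1 l

def smL (N c : ℕ) : List ℕ → List ℕ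
  | [] => []
  | a :: l => Nat.mod (Nat.mul c a) N :: smL N c l

def addL (N : ℕ) : List ℕ → List ℕ → List ℕ
  | [], m => m
  | a :: l, [] => a :: l
  | a :: l, b :: m => Nat.mod (Nat.add a b) N :: addL N l m

def mulL (N : ℕ) : List ℕ → List ℕ → List ℕ
  | [], _ => []
  | a :: l, m => addL N (smL N a m) (0 :: mulL N l m)

def dxs (N : ℕ) : ℕ → ℕ → List ℕ → List ℕ
  | 0, _, F => F
  | k + 1, m, F => force (Nat.mod (Nat.add m (Nat.pred N)) N) fun m' =>
    forceL (lin N m (Nat.pred N) F) fun F' => dxs N k m' F'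

def dys (N : ℕ) : ℕ → List ℕ → List ℕ
  | 0, F => F
  | k + 1, F => forceL (derL N F) fun F' => dys N k F'

/-- the coefficient of a term of the transvectant -/
def cf (N i j : ℕ) : ℕ :=
  Nat.mod (Nat.mul (Nat.div (Nat.factorial (Nat.add i j)) (Nat.mul (Nat.factorial i) (Nat.factorial j)))
    (Nat.pow (Nat.pred N) i)) N

def term (N m n i j : ℕ) (F G : List ℕ) : List ℕ :=
  force (Nat.mod (Nat.add m (Nat.mul i (Nat.pred N))) N) fun m' =>
  force (Nat.mod (Nat.add n (Nat.mul j (Nat.pred N))) N) fun n' =>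
  forceL (dys N i F) fun F1 => forceL (dxs N j m' F1) fun F2 =>
  forceL (dys N j G) fun G1 => forceL (dxs N i n' G1) fun G2 =>
  force (cf N i j) fun c => forceL (smL N c F2) fun F3 => mulL N F3 G2

def sumB (N m n k : ℕ) (F G : List ℕ) : ℕ → List ℕ
  | 0 => []
  | i + 1 => forceL (sumB N m n k F G i) fun S => force i fun i => force (Nat.sub k i) fun j =>
    forceL (term N m n i j F G) fun T => addL N S T

def TrL (N k m n : ℕ) (F G : List ℕ) : List ℕ := sumB N m n k F G (k + 1)

def runL (N : ℕ) (s : List (ℕ × List ℕ)) : List (ℕ × ℕ × ℕ) → List (ℕ × List ℕ)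
  | [] => s
  | (i, j, k) :: l =>
    match s.getD i (0, []), s.getD j (0, []) with
    | (mi, F), (mj, G) =>
      force (Nat.mod (mi + mj + 2 * k * Nat.pred N) N) fun m =>
      forceL (TrL N k mi mj F G) fun H => runL N (s ++ [(m, H)]) l

variable {K : Type} [CommRing K]

noncomputable def den : List ℕ → Polynomial K
  | [] => 0
  | a :: l => (a : Polynomial K) + Polynomial.X * den l

theorem den_consT (a : ℕ) (l : List ℕ) : (den (consT a l) : Polynomial K) = den (a :: l) := by
  rw [consT, force_eq]
  cases a <;> cases l <;> simp [den]

variable {N : ℕ} (hN : (N : K) = 0)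
include hN

theorem castP : (N : Polynomial K) = 0 := by
  have := congrArg Polynomial.C hN
  simpa using this

theorem cast_mod (a : ℕ) : ((Nat.mod a N : ℕ) : K) = a := by
  conv_rhs => rw [← Nat.mod_add_div a N]
  push_cast
  rw [hN]; simp [HMod.hMod, Mod.mod]

theorem cast_modP (a : ℕ) : ((Nat.mod a N : ℕ) : Polynomial K) = a := cast_mod (castP hN) a

theorem den_smL (c : ℕ) (l : List ℕ) :
    (den (smL N c l) : Polynomial K) = (c : Polynomial K) * den l := by
  induction l with
  | nil => simp [smL, den]
  | cons a l ih =>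
    rw [smL, den, den, ih, cast_modP hN]
    have : ((Nat.mul c a : ℕ) : Polynomial K) = c * a := Nat.cast_mul c a
    rw [this]; ring

theorem den_addL (l m : List ℕ) : (den (addL N l m) : Polynomial K) = den l + den m := by
  induction l generalizing m with
  | nil => simp [addL, den]
  | cons a l ih =>
    cases m with
    | nil => simp [addL, den]
    | cons b m =>
      rw [addL, den, den, den, ih, cast_modP hN]
      have : ((Nat.add a b : ℕ) : Polynomial K) = a + b := Nat.cast_add a b
      rw [this]; ring

theorem den_mulL (l m : List ℕ) : (den (mulL N l m) : Polynomial K) = den l * den m := by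
  induction l with
  | nil => simp [mulL, den]
  | cons a l ih => rw [mulL, den_addL hN, den_smL hN, den, den, ih]; push_cast; ring

theorem den_lin (c s : ℕ) (l : List ℕ) : (den (lin N c s l) : Polynomial K) =
    (c : Polynomial K) * den l + (s : Polynomial K) * (Polynomial.X * Polynomial.derivative (den l)) := by
  induction l generalizing c with
  | nil => simp [lin, den]
  | cons a l ih =>
    rw [lin, force_eq, den_consT, den, den, ih, cast_modP hN, cast_modP hN]
    have h1 : ((Nat.mul c a : ℕ) : Polynomial K) = c * a := Nat.cast_mul c a
    have h2 : ((Nat.add c s : ℕ) : Polynomial K) = c + s := Nat.cast_add c s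
    rw [h1, h2]
    simp only [Polynomial.derivative_add, Polynomial.derivative_natCast, Polynomial.derivative_mul,
      Polynomial.derivative_X]
    ring

theorem den_derL (l : List ℕ) : (den (derL N l) : Polynomial K) = Polynomial.derivative (den l) := by
  cases l with
  | nil => simp [derL, den]
  | cons a l =>
    rw [derL, den_lin hN, den]
    simp only [Polynomial.derivative_add, Polynomial.derivative_natCast, Polynomial.derivative_mul,
      Polynomial.derivative_X]
    push_cast; ring

variable (hpos : 0 < N)
include hpos

theorem cast_pred : ((Nat.pred N : ℕ) : K) = -1 := by
  obtain ⟨M, rfl⟩ := Nat.exists_eq_succ_of_ne_zero hpos.ne'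
  have : ((M : K) + 1) = 0 := by exact_mod_cast hN
  simp only [Nat.pred_succ]
  linear_combination this

theorem den_dx (m : ℕ) (m' : ℤ) (hm : (m : K) = m') (l : List ℕ) :
    (den (lin N m (Nat.pred N) l) : Polynomial K) = dx m' (den l) := by
  have hm' : (m : Polynomial K) = m' := by simpa using congrArg Polynomial.C hm
  rw [den_lin hN, dx, cast_pred (castP hN) hpos, hm']; ring

theorem cast_prev (m i : ℕ) (m' : ℤ) (hm : (m : K) = m') :
    ((Nat.mod (Nat.add m (Nat.mul i (Nat.pred N))) N : ℕ) : K) = ((m' - i : ℤ) : K) := by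
  have h2 : ((Nat.add m (Nat.mul i (Nat.pred N)) : ℕ) : K) = m + i * (Nat.pred N : ℕ) := by
    rw [← Nat.cast_mul, ← Nat.cast_add]; rfl
  rw [cast_mod hN, h2, cast_pred hN hpos, hm]; push_cast; ring

theorem den_dxs (k m : ℕ) (m' : ℤ) (hm : (m : K) = m') (F : List ℕ) :
    (den (dxs N k m F) : Polynomial K) = DX k m' (den F) := by
  induction k generalizing m m' F with
  | zero => rfl
  | succ k ih =>
    have hp : ((Nat.mod (Nat.add m (Nat.pred N)) N : ℕ) : K) = ((m' - 1 : ℤ) : K) := by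
      have := cast_prev hN hpos m 1 m' hm
      have e : Nat.mul 1 (Nat.pred N) = Nat.pred N := Nat.one_mul _
      rw [e] at this
      simpa using this
    rw [dxs, DX, force_eq, forceL_eq, ih _ _ hp, den_dx hN hpos m m' hm]

omit hpos in
theorem den_dys (k : ℕ) (F : List ℕ) :
    (den (dys N k F) : Polynomial K) = Polynomial.derivative^[k] (den F) := by
  induction k generalizing F with
  | zero => rfl
  | succ k ih => rw [dys, forceL_eq, ih, den_derL hN, Function.iterate_succ_apply]

theorem cast_cf (i j : ℕ) : ((cf N i j : ℕ) : K) = ((i + j).choose i : K) * (-1) ^ i := by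
  rw [cf, cast_mod hN]
  have h1 : Nat.div (Nat.factorial (Nat.add i j)) (Nat.mul (Nat.factorial i) (Nat.factorial j))
      = (i + j).choose i := by
    rw [Nat.choose_eq_factorial_div_factorial (Nat.le_add_right i j), Nat.add_sub_cancel_left]; rfl
  rw [h1]
  have h2 : ∀ a : ℕ, Nat.mul a (Nat.pow (Nat.pred N) i) = a * (Nat.pred N) ^ i := fun a => rfl
  rw [h2, Nat.cast_mul, Nat.cast_pow, cast_pred hN hpos]

theorem den_term (m n i j : ℕ) (m' n' : ℤ) (hm : (m : K) = m') (hn : (n : K) = n') (F G : List ℕ) :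
    (den (term N m n i j F G) : Polynomial K) = ((i + j).choose i : Polynomial K) *
      tf m' n' (den F) (den G) i j := by
  simp only [term, force_eq, forceL_eq]
  rw [den_mulL hN, den_smL hN, den_dxs hN hpos _ _ _ (cast_prev hN hpos m i m' hm),
    den_dxs hN hpos _ _ _ (cast_prev hN hpos n j n' hn), den_dys hN, den_dys hN,
    cast_cf (castP hN) hpos, tf]
  ring

theorem den_TrL (k m n : ℕ) (m' n' : ℤ) (hm : (m : K) = m') (hn : (n : K) = n') (F G : List ℕ) :
    (den (TrL N k m n F G) : Polynomial K) = Tr k m' n' (den F) (den G) := by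
  rw [Tr_binom, Finset.Nat.sum_antidiagonal_eq_sum_range_succ_mk]
  have h : ∀ a, a ≤ k + 1 → (den (sumB N m n k F G a) : Polynomial K) =
      ∑ i ∈ Finset.range a, (k.choose i : Polynomial K) * tf m' n' (den F) (den G) i (k - i) := by
    intro a
    induction a with
    | zero => intro _; simp [sumB, den]
    | succ a ih =>
      intro ha
      rw [Finset.sum_range_succ, ← ih (by omega)]
      simp only [sumB, force_eq, forceL_eq]
      have e : Nat.sub k a = k - a := rfl
      rw [den_addL hN, den_term hN hpos _ _ _ _ _ _ hm hn, e, Nat.add_sub_cancel' (by omega)]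
  exact h (k + 1) le_rfl

theorem runL_ok (l : List (ℕ × ℕ × ℕ)) (s : List (ℕ × List ℕ)) (t : List (ℤ × Polynomial K))
    (h : List.Forall₂ (fun p q => (p.1 : K) = q.1 ∧ den p.2 = q.2) s t) :
    List.Forall₂ (fun p q => (p.1 : K) = q.1 ∧ den p.2 = q.2) (runL N s l) (run t l) := by
  induction l generalizing s t with
  | nil => exact h
  | cons a l ih =>
    obtain ⟨i, j, k⟩ := a
    have hg : ∀ i, ((s.getD i (0,[])).1 : K) = (t.getD i (0,0)).1 ∧
        den (s.getD i (0,[])).2 = (t.getD i (0,0)).2 := by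
      clear ih
      induction h with
      | nil => intro i; simp [den]
      | cons h1 h2 ih =>
        intro i
        cases i with
        | zero => simpa using h1
        | succ i => rw [List.getD_cons_succ, List.getD_cons_succ]; exact ih i
    rw [runL, run]
    simp only [force_eq, forceL_eq]
    apply ih
    apply List.rel_append h
    refine List.Forall₂.cons ⟨?_, ?_⟩ List.Forall₂.nil
    · rw [cast_mod hN]
      push_cast
      rw [(hg i).1, (hg j).1, cast_pred hN hpos]; push_cast; ring
    · rw [den_TrL hN hpos k _ _ _ _ (hg i).1 (hg j).1, (hg i).2, (hg j).2]

end num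

/-- numeric values of all constant coefficients -/
def valsL (N : ℕ) (q : List ℕ) (l : List (ℕ × ℕ × ℕ)) : List ℕ :=
  forceL (List.zipWith (fun a b => Nat.mod (Nat.mul a b) N) [1, 7, 21, 35, 35, 21, 7, 1] q) fun f =>
  (runL N [(7, f)] l).map fun p => p.2.headD 0

theorem valsL_ok {K : Type} [CommRing K] {N : ℕ} (hN : (N : K) = 0) (hpos : 0 < N)
    (a0 a1 a2 a3 a4 a5 a6 a7 : ℕ) (l : List (ℕ × ℕ × ℕ)) (i : ℕ) :
    (((valsL N [a0, a1, a2, a3, a4, a5, a6, a7] l).getD i 0 : ℕ) : K) =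
      cv l ![(a0 : K), a1, a2, a3, a4, a5, a6, a7] i := by
  have h0 : (den (List.zipWith (fun a b => Nat.mod (Nat.mul a b) N) [1, 7, 21, 35, 35, 21, 7, 1]
      [a0, a1, a2, a3, a4, a5, a6, a7]) : Polynomial K) = base ![(a0 : K), a1, a2, a3, a4, a5, a6, a7] := by
    have hm : ∀ a b : ℕ, ((Nat.mul a b : ℕ) : Polynomial K) = a * b := fun a b => Nat.cast_mul a b
    simp only [List.zipWith_cons_cons, List.zipWith_nil_left, den, cast_modP hN, hm]
    simp [base, Fin.sum_univ_succ, ← Polynomial.C_mul_X_pow_eq_monomial, Nat.choose]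
    ring
  have hr := runL_ok hN hpos l [(7, _)] [(7, _)] (List.Forall₂.cons ⟨by simp, h0⟩ List.Forall₂.nil)
  rw [cv, valsL, forceL_eq]
  have hg : ∀ (s : List (ℕ × List ℕ)) (t : List (ℤ × Polynomial K)),
      List.Forall₂ (fun p q => (p.1 : K) = q.1 ∧ den p.2 = q.2) s t → ∀ i,
      ((((s.map fun p => p.2.headD 0).getD i 0 : ℕ)) : K) = (t.getD i (0,0)).2.coeff 0 := by
    intro s t h
    induction h with
    | nil => intro i; simp
    | cons h1 h2 ih =>
      intro i
      cases i with
      | zero =>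
        rw [List.map_cons, List.getD_cons_zero, List.getD_cons_zero, ← h1.2]
        rename_i p _ _ _
        obtain ⟨_, p⟩ := p
        cases p <;> simp [den]
      | succ i => rw [List.map_cons, List.getD_cons_succ, List.getD_cons_succ]; exact ih i
  exact hg _ _ hr i

end Septic

namespace Septic

def prog : List (ℕ × ℕ × ℕ) :=
  [(0,0,4), (0,0,6), (1,1,4), (2,3,0), (1,2,2), (1,3,2), (0,5,3), (4,2,1), (0,2,2), (2,7,1),
   (4,0,4), (9,5,2), (3,5,3), (3,6,4), (2,14,1), (3,14,2),
   (3,3,4), (3,5,4), (5,5,4),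
   (7,10,5), (7,11,5), (7,12,5), (4,4,6), (4,6,6), (6,6,6),
   (10,11,5), (10,12,5), (11,12,5), (6,8,6), (13,14,2), (15,16,2), (14,14,2)]

end Septic

namespace Septic

def ptsL : List (ℕ × ℕ × ℕ × ℕ) :=
  [(2, 9, 1, 4), (1, 7, 7, 7), (6, 3, 1, 7), (0, 6, 6, 9), (0, 7, 4, 3), (9, 1, 5, 0), (6, 3, 6, 0),
  (8, 3, 7, 7), (8, 3, 5, 3), (3, 7, 4, 0), (6, 8, 1, 2), (4, 1, 5, 8), (6, 8, 3, 4), (4, 9, 7, 8),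
  (6, 9, 0, 7), (3, 6, 6, 2), (7, 8, 1, 2), (8, 6, 5, 7), (0, 7, 0, 4), (9, 9, 9, 6), (2, 2, 8, 3),
  (0, 3, 8, 8), (3, 6, 8, 5), (9, 5, 7, 4), (8, 9, 0, 6)]

def prs26 : List (ℕ × ℕ) :=
  [(20, 26), (20, 27), (20, 28), (20, 29), (21, 26), (21, 27), (21, 28), (21, 29), (22, 26), (22,
  27), (22, 28), (22, 29), (23, 26), (23, 27), (23, 28), (23, 29), (24, 26), (24, 27), (24, 29),
  (25, 26), (25, 27), (25, 29), (17, 30), (18, 30), (19, 30)]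

def prs20 : List (ℕ × ℕ) :=
  [(17, 20), (17, 21), (17, 22), (17, 23), (17, 24), (17, 25), (18, 20), (18, 21), (18, 22), (18,
  23), (18, 24), (18, 25), (19, 20), (19, 21), (19, 22), (19, 23)]

def inv26 : List (List ℕ) := [
  [26, 5, 34, 59, 76, 89, 69, 89, 24, 99, 57, 8, 1, 27, 54, 42, 41, 28, 86, 29, 39, 7, 17, 36, 40],
  [63, 75, 74, 70, 45, 92, 93, 74, 12, 3, 82, 68, 58, 21, 69, 70, 10, 66, 38, 55, 23, 78, 73, 17, 39],
  [93, 51, 35, 38, 85, 89, 22, 51, 1, 67, 27, 29, 40, 94, 59, 76, 73, 71, 77, 11, 44, 22, 35, 1, 78],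
  [83, 55, 96, 17, 1, 72, 3, 39, 47, 29, 13, 6, 91, 94, 20, 97, 28, 35, 41, 7, 4, 16, 27, 68, 19],
  [98, 8, 68, 53, 52, 93, 47, 73, 88, 56, 94, 59, 4, 18, 69, 73, 2, 29, 72, 25, 10, 38, 28, 27, 46],
  [51, 35, 12, 56, 3, 44, 18, 1, 7, 69, 11, 70, 22, 6, 0, 27, 57, 67, 68, 73, 79, 31, 60, 80, 24],
  [34, 42, 45, 24, 38, 33, 47, 28, 31, 34, 20, 34, 29, 22, 76, 74, 24, 35, 97, 46, 51, 64, 82, 17, 86],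
  [32, 92, 95, 83, 51, 31, 39, 0, 70, 40, 58, 75, 80, 71, 16, 7, 22, 55, 57, 14, 97, 57, 35, 95, 26],
  [75, 35, 89, 83, 27, 35, 26, 21, 88, 11, 60, 0, 14, 8, 90, 61, 42, 70, 13, 69, 34, 87, 37, 95, 32],
  [27, 98, 96, 45, 56, 4, 99, 25, 72, 61, 98, 66, 44, 72, 42, 43, 7, 88, 98, 86, 83, 64, 60, 94, 11],
  [55, 33, 81, 56, 36, 25, 68, 7, 71, 96, 2, 55, 28, 31, 30, 22, 72, 81, 87, 93, 80, 7, 89, 70, 11],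
  [7, 48, 79, 60, 2, 39, 85, 60, 91, 88, 43, 14, 83, 39, 56, 61, 15, 14, 20, 89, 74, 40, 27, 7, 35],
  [24, 66, 10, 5, 94, 2, 10, 55, 90, 71, 51, 29, 46, 56, 28, 50, 53, 33, 22, 80, 53, 53, 38, 57, 62],
  [9, 52, 89, 100, 52, 52, 94, 93, 98, 82, 24, 77, 60, 43, 76, 95, 30, 17, 19, 38, 53, 60, 90, 65, 31],
  [73, 52, 47, 53, 45, 72, 78, 55, 3, 64, 17, 78, 16, 46, 42, 67, 35, 48, 61, 25, 90, 50, 60, 56, 56],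
  [61, 65, 86, 57, 58, 32, 79, 100, 3, 90, 83, 95, 95, 0, 44, 65, 38, 10, 55, 90, 11, 61, 96, 3, 100],
  [46, 30, 24, 40, 63, 80, 19, 27, 91, 69, 69, 76, 74, 45, 59, 78, 82, 5, 13, 4, 54, 63, 35, 64, 49],
  [19, 44, 24, 97, 16, 76, 61, 76, 50, 80, 85, 6, 79, 40, 63, 20, 58, 99, 5, 9, 21, 8, 64, 88, 63],
  [49, 43, 74, 33, 25, 6, 40, 76, 50, 92, 60, 23, 100, 55, 55, 89, 61, 17, 69, 53, 17, 33, 37, 92, 39],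
  [40, 90, 57, 8, 35, 7, 72, 60, 94, 4, 25, 11, 83, 16, 78, 75, 2, 46, 27, 82, 97, 18, 98, 10, 84],
  [30, 72, 45, 95, 6, 25, 19, 47, 82, 28, 40, 10, 78, 96, 99, 65, 48, 52, 35, 38, 52, 43, 49, 15, 80],
  [25, 31, 57, 72, 92, 9, 86, 31, 11, 75, 86, 47, 57, 49, 1, 29, 71, 55, 34, 7, 65, 87, 15, 53, 78],
  [65, 54, 43, 10, 7, 87, 49, 38, 1, 66, 52, 45, 9, 26, 4, 95, 87, 95, 80, 23, 50, 9, 61, 29, 0],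
  [24, 14, 25, 75, 39, 41, 92, 97, 87, 0, 83, 48, 31, 5, 91, 5, 76, 21, 52, 84, 40, 28, 14, 20, 0],
  [31, 64, 60, 83, 12, 93, 85, 54, 36, 4, 14, 1, 6, 68, 37, 51, 54, 43, 2, 4, 15, 50, 7, 21, 39]]

def inv20 : List (List ℕ) := [
  [84, 8, 23, 84, 73, 33, 11, 1, 89, 0, 75, 83, 40, 94, 70, 60],
  [98, 94, 4, 79, 61, 1, 86, 83, 81, 24, 35, 68, 4, 15, 20, 59],
  [95, 19, 93, 78, 38, 86, 21, 68, 0, 18, 10, 48, 12, 30, 74, 82],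
  [11, 8, 98, 63, 44, 93, 83, 30, 26, 82, 10, 60, 21, 56, 31, 84],
  [8, 88, 31, 91, 51, 54, 87, 74, 99, 75, 0, 65, 65, 88, 86, 24],
  [49, 24, 86, 48, 81, 1, 97, 48, 95, 41, 55, 16, 11, 12, 78, 16],
  [33, 6, 91, 62, 76, 56, 2, 25, 74, 5, 82, 37, 52, 75, 91, 18],
  [92, 94, 91, 91, 96, 2, 24, 17, 39, 69, 15, 45, 6, 0, 90, 7],
  [57, 24, 90, 89, 76, 28, 20, 13, 86, 45, 13, 37, 58, 65, 58, 13],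
  [31, 88, 52, 40, 16, 13, 46, 63, 32, 2, 27, 42, 47, 90, 6, 15],
  [77, 8, 18, 33, 65, 20, 17, 51, 83, 61, 30, 73, 5, 44, 87, 94],
  [2, 85, 40, 21, 35, 98, 11, 18, 77, 88, 72, 72, 72, 37, 91, 86],
  [75, 96, 35, 1, 63, 11, 4, 31, 85, 54, 28, 51, 28, 8, 38, 82],
  [92, 25, 17, 99, 12, 54, 24, 38, 16, 59, 70, 51, 73, 76, 34, 33],
  [33, 82, 74, 66, 45, 15, 29, 36, 95, 27, 46, 90, 76, 45, 71, 62],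
  [77, 32, 24, 23, 95, 66, 89, 25, 44, 48, 27, 86, 25, 44, 57, 57]]

end Septic

namespace Septic

def dotF (N : ℕ) : ℕ → List ℕ → List ℕ → ℕ
  | 0, _, _ => 0
  | r + 1, l, m => force (dotF N r l.tail m.tail) fun s =>
    Nat.mod (Nat.add (Nat.mul (l.headD 0) (m.headD 0)) s) N

def rowL (N : ℕ) (v : List ℕ) (prs : List (ℕ × ℕ)) : List ℕ :=
  prs.map fun p => Nat.mod (Nat.mul (v.getD p.1 0) (v.getD p.2 0)) N

def chkCols (N r i : ℕ) (row : List ℕ) : ℕ → List (List ℕ) → Bool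
  | _, [] => true
  | k, c :: cs => (Nat.beq (dotF N r row c) (bif Nat.beq i k then 1 else 0)) &&
      force (Nat.succ k) fun k => chkCols N r i row k cs

def ptL (p : ℕ × ℕ × ℕ × ℕ) : List ℕ :=
  [1, 0, p.1, p.2.1, p.2.2.1, p.2.2.2, 10 * p.2.1 * p.2.1 + 86 * p.1 * p.2.2.1,
    5 * p.2.1 * p.2.2.1 + 92 * p.1 * p.2.2.2]

def chkPt (i : ℕ) (p : ℕ × ℕ × ℕ × ℕ) : Bool :=
  forceL (valsL 101 (ptL p) prog) fun v =>
    (forceL (rowL 101 v prs26) fun row => chkCols 101 25 i row 0 inv26) &&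
    (Nat.ble 16 i || forceL (rowL 101 v prs20) fun row => chkCols 101 16 i row 0 inv20)

def chkPts : ℕ → List (ℕ × ℕ × ℕ × ℕ) → Bool
  | _, [] => true
  | i, p :: ps => chkPt i p && force (Nat.succ i) fun i => chkPts i ps

set_option maxRecDepth 100000 in
theorem chk_all : chkPts 0 ptsL = true := by decide +kernel

end Septic

namespace Septic

theorem dotF_ok {K : Type} [CommRing K] {N : ℕ} (hN : (N : K) = 0) (r : ℕ) (l m : List ℕ) :
    ((dotF N r l m : ℕ) : K) = ∑ j : Fin r, ((l.getD j 0 : ℕ) : K) * ((m.getD j 0 : ℕ) : K) := by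
  induction r generalizing l m with
  | zero => simp [dotF]
  | succ r ih =>
    rw [dotF, force_eq, cast_mod hN, Fin.sum_univ_succ]
    have e : ∀ a b c : ℕ, Nat.add (Nat.mul a b) c = a * b + c := fun _ _ _ => rfl
    rw [e, Nat.cast_add, Nat.cast_mul, ih]
    cases l <;> cases m <;> simp

theorem chkCols_ok (N r i : ℕ) (row : List ℕ) (k : ℕ) (cs : List (List ℕ))
    (h : chkCols N r i row k cs = true) (j : ℕ) (hj : j < cs.length) :
    dotF N r row (cs.getD j []) = if i = k + j then 1 else 0 := by
  induction cs generalizing k j with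
  | nil => simp at hj
  | cons c cs ih =>
    rw [chkCols, force_eq, Bool.and_eq_true] at h
    obtain ⟨h1, h2⟩ := h
    cases j with
    | zero =>
      rw [List.getD_cons_zero, Nat.eq_of_beq_eq_true h1]
      by_cases e : i = k
      · subst e; simp
      · have : Nat.beq i k = false := by
          rw [Bool.eq_false_iff]; intro h; exact e (Nat.eq_of_beq_eq_true h)
        rw [this]; simp [e]
    | succ j =>
      rw [List.getD_cons_succ, ih _ h2 j (by simpa using hj)]
      congr 1; simp only [eq_iff_iff]; constructor <;> intro h <;> omega

theorem chkPts_ok (i : ℕ) (ps : List (ℕ × ℕ × ℕ × ℕ)) (h : chkPts i ps = true) (j : ℕ)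
    (hj : j < ps.length) : chkPt (i + j) (ps.getD j (0,0,0,0)) = true := by
  induction ps generalizing i j with
  | nil => simp at hj
  | cons p ps ih =>
    rw [chkPts, force_eq, Bool.and_eq_true] at h
    obtain ⟨h1, h2⟩ := h
    cases j with
    | zero => simpa using h1
    | succ j =>
      rw [List.getD_cons_succ]
      have := ih _ h2 j (by simpa using hj)
      rwa [show Nat.succ i + j = i + (j + 1) by omega] at this

def qv {B : Type} [CommRing B] (x2 x3 x4 x5 : B) : Fin 8 → B :=
  ![1, 0, x2, x3, x4, x5, 10 * x3 * x3 - 15 * x2 * x4, 5 * x3 * x4 - 9 * x2 * x5]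

def pt (i : ℕ) : ℕ × ℕ × ℕ × ℕ := ptsL.getD i (0,0,0,0)

/-- the `i`-th test point -/
def Q (B : Type) [CommRing B] (i : ℕ) : Fin 8 → B :=
  qv ((pt i).1 : B) ((pt i).2.1 : B) ((pt i).2.2.1 : B) ((pt i).2.2.2 : B)

theorem Q_map {B B' : Type} [CommRing B] [CommRing B'] (φ : B →+* B') (i : ℕ) :
    (fun j => φ (Q B i j)) = Q B' i := by
  funext j
  fin_cases j <;> simp [Q, qv, map_ofNat]

theorem vals_pt (i k : ℕ) :
    (((valsL 101 (ptL (pt i)) prog).getD k 0 : ℕ) : ZMod 101) = cv prog (Q (ZMod 101) i) k := by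
  have h0 : ((101 : ℕ) : ZMod 101) = 0 := by decide
  rw [ptL, valsL_ok h0 (by norm_num)]
  congr 1
  have h1 : (86 : ZMod 101) = -15 := by decide
  have h2 : (92 : ZMod 101) = -9 := by decide
  rw [Q, qv]
  push_cast
  rw [h1, h2]
  congr 1
  funext j
  fin_cases j <;> simp <;> ring

/-- matrix of values of products of invariants -/
noncomputable def Mt (B : Type) [CommRing B] (prs : List (ℕ × ℕ)) (r : ℕ) : Matrix (Fin r) (Fin r) B :=
  fun i j => cv prog (Q B i) (prs.getD j (0,0)).1 * cv prog (Q B i) (prs.getD j (0,0)).2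

theorem Mt_map {B B' : Type} [CommRing B] [CommRing B'] (φ : B →+* B') (prs : List (ℕ × ℕ)) (r : ℕ) :
    φ.mapMatrix (Mt B prs r) = Mt B' prs r := by
  ext i j
  simp only [RingHom.mapMatrix_apply, Matrix.map_apply, Mt, map_mul, cv_map, Q_map]

theorem Mt_det (prs : List (ℕ × ℕ)) (r : ℕ) (hr : prs.length = r) (inv : List (List ℕ))
    (hi : inv.length = r) (v : ℕ → List ℕ)
    (hv : ∀ i k, (((v i).getD k 0 : ℕ) : ZMod 101) = cv prog (Q (ZMod 101) i) k)
    (h : ∀ i < r, chkCols 101 r i (rowL 101 (v i) prs) 0 inv = true) :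
    (Mt ℂ prs r).det ≠ 0 := by
  have h0 : ((101 : ℕ) : ZMod 101) = 0 := by decide
  have hz : (Mt (ZMod 101) prs r).det ≠ 0 := by
    obtain ⟨I, hI⟩ : ∃ I : Matrix (Fin r) (Fin r) (ZMod 101), ∀ j k, I j k =
      (((inv.getD k []).getD j 0 : ℕ) : ZMod 101) := ⟨fun j k => _, fun _ _ => rfl⟩
    have hMI : Mt (ZMod 101) prs r * I = 1 := by
      ext i k
      have := chkCols_ok _ _ _ _ _ _ (h i i.2) k (by rw [hi]; exact k.2)
      have h2 := dotF_ok h0 r (rowL 101 (v i) prs) (inv.getD k [])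
      rw [this] at h2
      rw [Matrix.mul_apply, Matrix.one_apply]
      have e : (if i = k then (1 : ZMod 101) else 0) = ((if (i : ℕ) = 0 + k then 1 else 0 : ℕ) : ZMod 101) := by
        simp [Fin.ext_iff]
      rw [e, h2]
      refine Finset.sum_congr rfl fun j _ => ?_
      have hj : (j : ℕ) < prs.length := by rw [hr]; exact j.2
      have hrow : (((rowL 101 (v i) prs).getD j 0 : ℕ) : ZMod 101) = Mt (ZMod 101) prs r i j := by
        rw [rowL, List.getD_eq_getElem _ _ (by simpa using hj), List.getElem_map, cast_mod h0]
        have e2 : ∀ a b : ℕ, ((Nat.mul a b : ℕ) : ZMod 101) = a * b := fun a b => Nat.cast_mul a b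
        rw [e2, hv, hv, Mt, List.getD_eq_getElem _ _ hj]
      rw [hrow, hI]
    intro hd
    have := congrArg Matrix.det hMI
    rw [Matrix.det_mul, hd, zero_mul, Matrix.det_one] at this
    exact absurd this (by decide)
  have hZ : (Mt ℤ prs r).det ≠ 0 := by
    intro hd
    apply hz
    rw [← Mt_map (Int.castRingHom (ZMod 101)), ← RingHom.map_det, hd, map_zero]
  rw [← Mt_map (Int.castRingHom ℂ), ← RingHom.map_det]
  simpa using hZ

theorem chk_pt (i : ℕ) (hi : i < 25) : chkPt i (pt i) = true := by
  have := chkPts_ok 0 ptsL chk_all i hi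
  rwa [zero_add] at this

theorem det26 : (Mt ℂ prs26 25).det ≠ 0 := by
  refine Mt_det prs26 25 rfl inv26 rfl _ vals_pt fun i hi => ?_
  have := chk_pt i hi
  rw [chkPt, forceL_eq, Bool.and_eq_true, forceL_eq] at this
  exact this.1

theorem det20 : (Mt ℂ prs20 16).det ≠ 0 := by
  refine Mt_det prs20 16 rfl inv20 rfl _ vals_pt fun i hi => ?_
  have := chk_pt i (by omega)
  rw [chkPt, forceL_eq, Bool.and_eq_true, Bool.or_eq_true, forceL_eq, forceL_eq] at this
  rcases this.2 with h | h
  · have := Nat.le_of_ble_eq_true h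
    omega
  · exact h

end Septic

namespace Septic

noncomputable def inv4 : A :=
  4 * (MvPolynomial.X 0 * MvPolynomial.X 6 - 6 * MvPolynomial.X 1 * MvPolynomial.X 5
      + 15 * MvPolynomial.X 2 * MvPolynomial.X 4 - 10 * MvPolynomial.X 3 ^ 2)
    * (MvPolynomial.X 1 * MvPolynomial.X 7 - 6 * MvPolynomial.X 2 * MvPolynomial.X 6
      + 15 * MvPolynomial.X 3 * MvPolynomial.X 5 - 10 * MvPolynomial.X 4 ^ 2)
    - (MvPolynomial.X 0 * MvPolynomial.X 7 - 5 * MvPolynomial.X 1 * MvPolynomial.X 6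
      + 9 * MvPolynomial.X 2 * MvPolynomial.X 5 - 5 * MvPolynomial.X 3 * MvPolynomial.X 4) ^ 2

theorem der_num4 (D : Derivation ℂ A A) : D (9 : A) = 0 ∧ D (10 : A) = 0 ∧ D (15 : A) = 0 :=
  ⟨D.map_natCast 9, D.map_natCast 10, D.map_natCast 15⟩

theorem inv4_mem : inv4 ∈ V 4 := by
  rw [mem_V]
  refine ⟨?_, ?_, ?_⟩
  · have hX : ∀ i j : Fin 8, (MvPolynomial.X i * MvPolynomial.X j : A).IsHomogeneous 2 := fun i j =>
      (MvPolynomial.isHomogeneous_X ℂ i).mul (MvPolynomial.isHomogeneous_X ℂ j)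
    have hC : ∀ (c : ℂ) (i j : Fin 8),
        (MvPolynomial.C c * (MvPolynomial.X i * MvPolynomial.X j) : A).IsHomogeneous 2 := fun c i j => by
      simpa using (MvPolynomial.isHomogeneous_C (Fin 8) c).mul (hX i j)
    have h1 := (((hX 0 6).sub (hC 6 1 5)).add (hC 15 2 4)).sub (hC 10 3 3)
    have h2 := (((hX 1 7).sub (hC 6 2 6)).add (hC 15 3 5)).sub (hC 10 4 4)
    have h3 := (((hX 0 7).sub (hC 5 1 6)).add (hC 9 2 5)).sub (hC 5 3 4)
    have h4 := ((MvPolynomial.isHomogeneous_C (Fin 8) (4 : ℂ)).mul (h1.mul h2)).sub (h3.mul h3)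
    have aux : ∀ p : A, p.IsHomogeneous 4 → p = inv4 → inv4.IsHomogeneous 4 := fun p h e => e ▸ h
    refine aux _ h4 ?_
    simp only [inv4, map_ofNat]
    ring
  · simp only [inv4, D1, map_sub, map_add, Derivation.leibniz, Derivation.leibniz_pow,
      MvPolynomial.mkDerivation_X, smul_eq_mul, der_num, der_num4]
    simp
    ring
  · simp only [inv4, D2, map_sub, map_add, Derivation.leibniz, Derivation.leibniz_pow,
      MvPolynomial.mkDerivation_X, smul_eq_mul, der_num, der_num4]
    simp
    ring

theorem inv4_ne : inv4 ≠ 0 := by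
  intro h
  have := congrArg (MvPolynomial.eval (![1,0,0,0,0,0,0,1] : Fin 8 → ℂ)) h
  simp [inv4] at this

theorem inv4_Q (i : ℕ) : MvPolynomial.eval (Q ℂ i) inv4 = 0 := by
  simp [inv4, Q, qv]
  ring_nf
  exact Or.inl trivial

theorem W_le (n : ℕ) : W n ≤ V n := by
  rw [W, Submodule.span_le]
  rintro p ⟨g, h, a, b, _, _, rfl, hg, hh, g1, g2, h1, h2, rfl⟩
  rw [SetLike.mem_coe, mem_V]
  refine ⟨hg.mul hh, ?_, ?_⟩
  · rw [Derivation.leibniz, g1, h1]; simp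
  · rw [Derivation.leibniz, g2, h2]; simp

theorem mul_W {a b n : ℕ} (ha : 0 < a) (hb : 0 < b) (hab : a + b = n) {g h : A} (hg : g ∈ V a)
    (hh : h ∈ V b) : g * h ∈ W n := by
  rw [mem_V] at hg hh
  exact Submodule.subset_span ⟨g, h, a, b, ha, hb, hab, hg.1, hh.1, hg.2.1, hg.2.2, hh.2.1, hh.2.2, rfl⟩

theorem lowerW (m n r w : ℕ) (hw : 7 * n = 2 * w) (hm : 0 < m) (hn : 4 + m = n) (prs : List (ℕ × ℕ))
    (hdet : (Mt ℂ prs r).det ≠ 0)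
    (hp : ∀ j : Fin r, ∃ a b, 0 < a ∧ 0 < b ∧ a + b = n ∧
      cv prog (fun i => (MvPolynomial.X i : A)) (prs.getD j (0,0)).1 ∈ V a ∧
      cv prog (fun i => (MvPolynomial.X i : A)) (prs.getD j (0,0)).2 ∈ V b) [FiniteDimensional ℂ (V m)] :
    Module.finrank ℂ (V m) + r ≤ Module.finrank ℂ (W n) := by
  have := finV hw
  have : FiniteDimensional ℂ (W n) := Submodule.finiteDimensional_of_le (W_le n)
  set P : Fin r → A := fun j => cv prog (fun i => (MvPolynomial.X i : A)) (prs.getD j (0,0)).1 *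
    cv prog (fun i => (MvPolynomial.X i : A)) (prs.getD j (0,0)).2 with hP
  have hPW : ∀ j, P j ∈ W n := fun j => by
    obtain ⟨a, b, ha, hb, hab, h1, h2⟩ := hp j
    exact mul_W ha hb hab h1 h2
  have hPe : ∀ i j : Fin r, MvPolynomial.eval (Q ℂ i) (P j) = Mt ℂ prs r i j := fun i j => by
    simp only [hP, map_mul, cv_map, Mt, MvPolynomial.eval_X]
  let f0 : (V m × (Fin r → ℂ)) →ₗ[ℂ] A :=
    ((LinearMap.mulLeft ℂ inv4).comp (V m).subtype).coprod (Fintype.linearCombination ℂ P)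
  have hf0 : ∀ g c, f0 (g, c) = inv4 * (g : A) + ∑ j, c j • P j := fun g c => by
    simp [f0, Fintype.linearCombination_apply]
  let f : (V m × (Fin r → ℂ)) →ₗ[ℂ] W n := f0.codRestrict (W n) (by
    rintro ⟨g, c⟩
    rw [hf0]
    exact add_mem (mul_W (by norm_num) hm hn inv4_mem g.2)
      (Submodule.sum_mem _ fun j _ => Submodule.smul_mem _ _ (hPW j)))
  have hf : Function.Injective f := by
    rw [← LinearMap.ker_eq_bot, LinearMap.ker_eq_bot']
    rintro ⟨g, c⟩ h
    have h0 : inv4 * (g : A) + ∑ j, c j • P j = 0 := by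
      rw [← hf0]; exact congrArg Subtype.val h
    have hc : c = 0 := by
      apply Matrix.eq_zero_of_mulVec_eq_zero hdet
      funext i
      have := congrArg (MvPolynomial.eval (Q ℂ i)) h0
      rw [map_add, map_mul, inv4_Q, zero_mul, zero_add, map_sum, map_zero] at this
      rw [Pi.zero_apply, ← this, Matrix.mulVec, dotProduct]
      refine Finset.sum_congr rfl fun j _ => ?_
      rw [MvPolynomial.smul_eval, hPe, mul_comm]
    subst hc
    simp only [Pi.zero_apply, zero_smul, Finset.sum_const_zero, add_zero, mul_eq_zero, inv4_ne,
      false_or] at h0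
    ext1
    · exact Subtype.ext h0
    · rfl
  have := LinearMap.finrank_le_finrank_of_injective hf
  simpa using this

theorem cvV (i d : ℕ) (h : (sh [(1, 7)] prog).getD i (0,0) = (d, 0)) :
    cv prog (fun i => (MvPolynomial.X i : A)) i ∈ V d := cv_inv prog i d h

theorem W26 : 51 ≤ Module.finrank ℂ (W 26) := by
  have : FiniteDimensional ℂ (V 22) := finV (w := 77) (by norm_num)
  have := lowerW 22 26 25 91 (by norm_num) (by norm_num) (by norm_num) prs26 det26 (fun j => by
    rcases (show (∀ j : Fin 25, ((sh [(1, 7)] prog).getD (prs26.getD j (0,0)).1 (0,0) = (12, 0) ∧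
        (sh [(1, 7)] prog).getD (prs26.getD j (0,0)).2 (0,0) = (14, 0)) ∨
        ((sh [(1, 7)] prog).getD (prs26.getD j (0,0)).1 (0,0) = (8, 0) ∧
        (sh [(1, 7)] prog).getD (prs26.getD j (0,0)).2 (0,0) = (18, 0))) by decide +kernel) j with h | h
    · exact ⟨12, 14, by norm_num, by norm_num, by norm_num, cvV _ _ h.1, cvV _ _ h.2⟩
    · exact ⟨8, 18, by norm_num, by norm_num, by norm_num, cvV _ _ h.1, cvV _ _ h.2⟩)
  have := dim22
  omega

theorem W20 : 34 ≤ Module.finrank ℂ (W 20) := by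
  have : FiniteDimensional ℂ (V 16) := finV (w := 56) (by norm_num)
  have := lowerW 16 20 16 70 (by norm_num) (by norm_num) (by norm_num) prs20 det20 (fun j => by
    have h := (show (∀ j : Fin 16, ((sh [(1, 7)] prog).getD (prs20.getD j (0,0)).1 (0,0) = (8, 0) ∧
        (sh [(1, 7)] prog).getD (prs20.getD j (0,0)).2 (0,0) = (12, 0))) by decide +kernel) j
    exact ⟨8, 12, by norm_num, by norm_num, by norm_num, cvV _ _ h.1, cvV _ _ h.2⟩)
  have := dim16
  omega

theorem delta_eq (n : ℕ) (d : ℕ) [FiniteDimensional ℂ (V n)] (hV : Module.finrank ℂ (V n) ≤ d + 1)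
    (hW : d ≤ Module.finrank ℂ (W n)) (hne : ¬ V n ≤ W n) : delta n = 1 := by
  have h1 : Module.finrank ℂ (Submodule.comap (V n).subtype (W n)) = Module.finrank ℂ (W n) :=
    (Submodule.comapSubtypeEquivOfLe (W_le n)).finrank_eq
  have h2 := Submodule.finrank_quotient_add_finrank (Submodule.comap (V n).subtype (W n))
  have h3 : Module.finrank ℂ (W n) < Module.finrank ℂ (V n) :=
    Submodule.finrank_lt_finrank_of_lt (lt_of_le_not_ge (W_le n) hne)
  rw [delta]
  omega

end Septic

namespace Septic

theorem V_wt {n : ℕ} {f : A} (hf : f ∈ V n) (s : Fin 8 →₀ ℕ) (hs : f.coeff s ≠ 0) :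
    s 0 + s 1 + s 2 + s 3 + s 4 + s 5 + s 6 + s 7 = n ∧
    2 * (s 1 + 2 * s 2 + 3 * s 3 + 4 * s 4 + 5 * s 5 + 6 * s 6 + 7 * s 7) = 7 * n := by
  obtain ⟨h1, h2, h3⟩ := mem_V.mp hf
  have hd : ∑ i, s i = n := by
    have := h1 hs
    rw [Finsupp.weight_apply, Finsupp.sum_fintype _ _ (by simp)] at this
    simp at this
    exact this
  have h4 := comm_D1_D2 f
  rw [h2, h3, map_zero, map_zero, hom_iff.mp h1, zero_add] at h4
  have h5 := congrArg (MvPolynomial.coeff s) h4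
  simp only [Wt, MvPolynomial.coeff_sub, MvPolynomial.coeff_smul, coeff_diagD, smul_eq_mul,
    MvPolynomial.coeff_zero] at h5
  have h6 : (2 * (∑ i : Fin 8, (s i : ℂ) * ((i : ℕ) : ℂ)) - 7 * n) * f.coeff s = 0 := by
    linear_combination h5
  have h7 := (mul_eq_zero.mp h6).resolve_right hs
  have h8 : 2 * (∑ i : Fin 8, s i * (i : ℕ)) = 7 * n := by
    have : (2 * (∑ i : Fin 8, (s i : ℂ) * ((i : ℕ) : ℂ))) = 7 * n := by linear_combination h7
    exact_mod_cast this
  simp [Fin.sum_univ_succ, Fin.succ] at h8 hd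
  constructor
  · omega
  · omega

theorem V10 {f : A} (hf : f ∈ V 10) : f = 0 := by
  have : FiniteDimensional ℂ (V 10) := finV (w := 35) (by norm_num)
  have h := Submodule.finrank_eq_zero.mp dim10
  rw [h] at hf
  simpa using hf

theorem V6 {f : A} (hf : f ∈ V 6) : f = 0 := by
  have : FiniteDimensional ℂ (V 6) := finV (w := 21) (by norm_num)
  have h := Submodule.finrank_eq_zero.mp dim6
  rw [h] at hf
  simpa using hf

theorem W_coeff (n : ℕ) (hn : n = 20 ∨ n = 26) (s : Fin 8 →₀ ℕ)
    (hs : s 1 = 0 ∧ s 2 = 0 ∧ s 3 = 0 ∧ s 4 = 0 ∧ s 7 = 0 ∧ s 6 ≤ 1) {f : A} (hf : f ∈ W n) :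
    f.coeff s = 0 := by
  induction hf using Submodule.span_induction with
  | zero => simp
  | add x y _ _ hx hy => rw [MvPolynomial.coeff_add, hx, hy, add_zero]
  | smul c x _ hx => rw [MvPolynomial.coeff_smul, hx, smul_zero]
  | mem p hp =>
    obtain ⟨g, h, a, b, ha, hb, hab, hg, hh, g1, g2, h1, h2, rfl⟩ := hp
    have hg : g ∈ V a := mem_V.mpr ⟨hg, g1, g2⟩
    have hh : h ∈ V b := mem_V.mpr ⟨hh, h1, h2⟩
    rw [MvPolynomial.coeff_mul]
    refine Finset.sum_eq_zero fun p hp => ?_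
    have hp := Finset.HasAntidiagonal.mem_antidiagonal.mp hp
    by_contra hne
    obtain ⟨hne1, hne2⟩ := mul_ne_zero_iff.mp hne
    have e := fun i => DFunLike.congr_fun hp i
    simp only [Finsupp.add_apply] at e
    have e1 := e 1; have e2 := e 2; have e3 := e 3; have e4 := e 4; have e7 := e 7
    have e6 := e 6
    obtain ⟨u, v⟩ := p
    have aux : ∀ (u : Fin 8 →₀ ℕ) (a : ℕ), u 1 = 0 → u 2 = 0 → u 3 = 0 → u 4 = 0 → u 7 = 0 → u 6 = 0 →
        (u 0 + u 1 + u 2 + u 3 + u 4 + u 5 + u 6 + u 7 = a ∧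
        2 * (u 1 + 2 * u 2 + 3 * u 3 + 4 * u 4 + 5 * u 5 + 6 * u 6 + 7 * u 7) = 7 * a) →
        0 < a → a < 26 → a = 10 ∨ a = 20 := by
      intro u a k1 k2 k3 k4 k7 k6 hw h0 h26
      simp only [k1, k2, k3, k4, k7, k6, mul_zero, add_zero, zero_add] at hw
      omega
    have key : a = 10 ∨ a = 6 ∨ b = 10 ∨ b = 6 := by
      obtain ⟨s1, s2, s3, s4, s7, s6⟩ := hs
      simp only at e1 e2 e3 e4 e6 e7
      rcases Nat.eq_zero_or_pos (u 6) with h6 | h6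
      · have := aux u a (by omega) (by omega) (by omega) (by omega) (by omega) h6 (V_wt hg _ hne1) ha (by omega)
        omega
      · have := aux v b (by omega) (by omega) (by omega) (by omega) (by omega) (by omega) (V_wt hh _ hne2) hb (by omega)
        omega
    rcases key with rfl | rfl | rfl | rfl
    · rw [V10 hg] at hne1; simp at hne1
    · rw [V6 hg] at hne1; simp at hne1
    · rw [V10 hh] at hne2; simp at hne2
    · rw [V6 hh] at hne2; simp at hne2

theorem chk_low : Nat.beq (Nat.mod ((valsL 10201 [1, 0, 0, 0, 0, 1, 101, 0] prog).getD 31 0) 10201) 0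
    = false := by decide +kernel

theorem chk_low' : Nat.beq (Nat.mod ((valsL 10201 [1, 0, 0, 0, 0, 1, 101, 0] prog).getD 32 0) 10201) 0
    = false := by decide +kernel

theorem V_not_le (n k : ℕ) (hn : n = 20 ∨ n = 26)
    (hV : cv prog (fun i => (MvPolynomial.X i : A)) k ∈ V n)
    (v : List ℕ) (hv : v = valsL 10201 [1, 0, 0, 0, 0, 1, 101, 0] prog)
    (hk : Nat.beq (Nat.mod (v.getD k 0) 10201) 0 = false) : ¬ V n ≤ W n := by
  intro hle
  have h0 : ((10201 : ℕ) : ZMod 10201) = 0 := ZMod.natCast_self 10201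
  have hz : ((v.getD k 0 : ℕ) : ZMod 10201) ≠ 0 := by
    intro h
    rw [ZMod.natCast_eq_zero_iff] at h
    have h' : Nat.mod (v.getD k 0) 10201 = 0 := Nat.mod_eq_zero_of_dvd h
    rw [h'] at hk
    exact absurd hk (by decide)
  apply hz
  rw [hv, valsL_ok h0 (by norm_num)]
  set GZ : MvPolynomial (Fin 8) ℤ := cv prog (fun i => MvPolynomial.X i) k with hGZ
  have hmap : MvPolynomial.map (Int.castRingHom ℂ) GZ = cv prog (fun i => (MvPolynomial.X i : A)) k := by
    rw [hGZ, cv_map]; simp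
  set q : Fin 8 → ZMod 10201 := ![((1:ℕ) : ZMod 10201), (0:ℕ), (0:ℕ), (0:ℕ), (0:ℕ), (1:ℕ), (101:ℕ), (0:ℕ)] with hq
  have hev : MvPolynomial.eval₂Hom (Int.castRingHom (ZMod 10201)) q GZ = cv prog q k := by
    rw [hGZ, cv_map]; simp
  rw [← hev, MvPolynomial.coe_eval₂Hom, MvPolynomial.eval₂_eq']
  refine Finset.sum_eq_zero fun s hs => ?_
  have hsz : GZ.coeff s ≠ 0 := MvPolynomial.mem_support_iff.mp hs
  have hsC : (cv prog (fun i => (MvPolynomial.X i : A)) k).coeff s ≠ 0 := by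
    rw [← hmap, MvPolynomial.coeff_map]
    simpa using hsz
  have hw := V_wt hV s hsC
  rw [Fin.prod_univ_eight]
  by_cases c1 : s 1 = 0
  swap
  · simp [hq, c1]
  by_cases c2 : s 2 = 0
  swap
  · simp [hq, c2]
  by_cases c3 : s 3 = 0
  swap
  · simp [hq, c3]
  by_cases c4 : s 4 = 0
  swap
  · simp [hq, c4]
  by_cases c7 : s 7 = 0
  swap
  · simp [hq, c7]
  by_cases c6 : s 6 ≤ 1
  · exact absurd (W_coeff n hn s ⟨c1, c2, c3, c4, c7, c6⟩ (hle hV)) hsC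
  · obtain ⟨m, hm⟩ : ∃ m, s 6 = 2 + m := ⟨s 6 - 2, by omega⟩
    have h6 : q 6 ^ s 6 = 0 := by
      rw [hm, pow_add]
      have : q 6 ^ 2 = ((10201 : ℕ) : ZMod 10201) := by simp [hq]; norm_num
      rw [this, h0, zero_mul]
    rw [h6]; ring

end Septic

/-- There is exactly one new irreducible invariant of the binary septimic in each of
the degrees 20 and 26: `δ₂₀ = 1` and `δ₂₆ = 1`. -/
theorem delta_twenty_twentysix : delta 20 = 1 ∧ delta 26 = 1 := by
  have : FiniteDimensional ℂ (V 20) := Septic.finV (w := 70) (by norm_num)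
  have : FiniteDimensional ℂ (V 26) := Septic.finV (w := 91) (by norm_num)
  refine ⟨Septic.delta_eq 20 34 Septic.dim20 Septic.W20 ?_, Septic.delta_eq 26 51 Septic.dim26 Septic.W26 ?_⟩
  · exact Septic.V_not_le 20 32 (Or.inl rfl) (Septic.cvV 32 20 (by decide +kernel)) _ rfl Septic.chk_low'
  · exact Septic.V_not_le 26 31 (Or.inr rfl) (Septic.cvV 31 26 (by decide +kernel)) _ rfl Septic.chk_low
end
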